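/- arXiv:math/0306169 — 5 statements merged into one kernel-verified Lean document; each statement's English description precedes it below -/
import Mathlib

section
/- Let k be a differential field of characteristic zero and P ∈ k{x} an irreducible differential polynomial of order N ≥ 0. Every prime differential ideal of k{x} that contains P and is distinct from I(P) = {Q ∈ k{x} : S_P^m · Q ∈ ⟨P⟩ for some m ∈ ℕ} contains a nonzero element of order strictly less than N. -/
section UnivariateLemmas

open Polynomial in
lemma aux_pseudo_division {R : Type*} [CommRing R] [IsDomain R] (J : Ideal R[X]) (m : R[X])
    (hm : m ∈ J) (hm0 : m ≠ 0) (hmin : ∀ f ∈ J, f ≠ 0 → m.natDegree ≤ f.natDegree) :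
    ∀ (n : ℕ) (f : R[X]), f ∈ J → f.natDegree < n → ∃ c : R, c ≠ 0 ∧ m ∣ C c * f := by
  intro n
  induction n with
  | zero => intro f _ h; omega
  | succ n ih =>
    intro f hf hn
    by_cases hf0 : f = 0
    · exact ⟨1, one_ne_zero, by simp [hf0]⟩
    have hle := hmin f hf hf0
    have hlm : m.leadingCoeff ≠ 0 := leadingCoeff_ne_zero.mpr hm0
    have hlf : f.leadingCoeff ≠ 0 := leadingCoeff_ne_zero.mpr hf0
    set g := C m.leadingCoeff * f - C f.leadingCoeff * X ^ (f.natDegree - m.natDegree) * m with hg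
    have hgJ : g ∈ J := J.sub_mem (J.mul_mem_left _ hf) (J.mul_mem_left _ hm)
    have key : ∃ c : R, c ≠ 0 ∧ m ∣ C c * g := by
      by_cases hg0 : g = 0
      · exact ⟨1, one_ne_zero, by simp [hg0]⟩
      apply ih g hgJ
      have h1 : (C m.leadingCoeff * f).degree = f.degree := degree_C_mul hlm
      have h2 : (C f.leadingCoeff * X ^ (f.natDegree - m.natDegree) * m).degree = f.degree := by
        rw [degree_mul, degree_C_mul_X_pow _ hlf, degree_eq_natDegree hm0, degree_eq_natDegree hf0]
        norm_cast
        omega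
      have hlt : g.degree < (C m.leadingCoeff * f).degree := by
        apply degree_sub_lt (h1.trans h2.symm)
        · exact mul_ne_zero (C_ne_zero.mpr hlm) hf0
        · rw [leadingCoeff_mul, leadingCoeff_mul, leadingCoeff_mul, leadingCoeff_C, leadingCoeff_C,
            leadingCoeff_X_pow, mul_one, mul_comm]
      rw [h1] at hlt
      have := natDegree_lt_natDegree hg0 hlt
      omega
    obtain ⟨c, hc, hd⟩ := key
    refine ⟨c * m.leadingCoeff, mul_ne_zero hc hlm, ?_⟩
    have : C (c * m.leadingCoeff) * f
        = C c * g + m * (C c * (C f.leadingCoeff * X ^ (f.natDegree - m.natDegree))) := by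
      rw [hg, C_mul]; ring
    rw [this]
    exact dvd_add hd (dvd_mul_right _ _)

open Polynomial in
lemma aux_dvd_of_mem {R : Type*} [CommRing R] [IsDomain R] (J : Ideal R[X])
    (h0 : ∀ c : R, C c ∈ J → c = 0) (p : R[X]) (hp : Prime p) (hpJ : p ∈ J)
    (f : R[X]) (hf : f ∈ J) : p ∣ f := by
  classical
  have hex : ∃ n, ∃ m ∈ J, m ≠ 0 ∧ m.natDegree = n := ⟨_, p, hpJ, hp.ne_zero, rfl⟩
  obtain ⟨m, hm, hm0, hmn⟩ := Nat.find_spec hex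
  have hmin : ∀ f ∈ J, f ≠ 0 → m.natDegree ≤ f.natDegree := by
    intro f hf hf0
    rw [hmn]
    exact Nat.find_min' hex ⟨f, hf, hf0, rfl⟩
  have hC : ∀ g ∈ J, g ≠ 0 → ∀ c : R, c ≠ 0 → ¬ g ∣ C c := by
    intro g hg hg0 c hc hd
    have h1 := natDegree_le_of_dvd hd (C_ne_zero.mpr hc)
    rw [natDegree_C] at h1
    have h2 := eq_C_of_natDegree_le_zero h1
    rw [h2] at hg
    have := h0 _ hg
    rw [this, C_0] at h2
    exact hg0 h2
  have hpm : p ∣ m := by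
    obtain ⟨c, hc, t, ht⟩ := aux_pseudo_division J m hm hm0 hmin _ p hpJ (Nat.lt_succ_self _)
    have : p ∣ m * t := ⟨C c, by rw [← ht]; ring⟩
    rcases hp.dvd_or_dvd this with h | ⟨s, hs⟩
    · exact h
    · exfalso
      apply hC m hm hm0 c hc
      refine ⟨s, mul_right_cancel₀ hp.ne_zero ?_⟩
      rw [ht, hs]; ring
  obtain ⟨c, hc, hd⟩ := aux_pseudo_division J m hm hm0 hmin _ f hf (Nat.lt_succ_self _)
  rcases hp.dvd_or_dvd (hpm.trans hd) with h | h
  · exact absurd h (hC p hpJ hp.ne_zero c hc)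
  · exact h

end UnivariateLemmas

open MvPolynomial

section Embedding

/-- The injection sending `none` to `N` and `some i` to `i`. -/
def auxIdx (N : ℕ) : Option (Fin N) → ℕ
  | none => N
  | some i => i

lemma auxIdx_injective (N : ℕ) : Function.Injective (auxIdx N) := by
  rintro (_ | a) (_ | b) h
  · rfl
  · have := b.2; simp [auxIdx] at h; omega
  · have := a.2; simp [auxIdx] at h; omega
  · simp [auxIdx] at h; rw [Fin.ext h]

/-- Embedding of `k[x_0,…,x_{N-1}][x_N]` in `k[x_0,x_1,…]`. -/
noncomputable def auxEmb (k : Type*) [Field k] (N : ℕ) :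
    Polynomial (MvPolynomial (Fin N) k) →ₐ[k] MvPolynomial ℕ k :=
  (rename (auxIdx N)).comp (optionEquivLeft k (Fin N)).symm.toAlgHom

variable {k : Type*} [Field k] {N : ℕ}

lemma auxEmb_C (c : MvPolynomial (Fin N) k) :
    auxEmb k N (Polynomial.C c) = rename (fun i : Fin N => (i : ℕ)) c := by
  have : (optionEquivLeft k (Fin N)).symm (Polynomial.C c) = rename some c := by
    rw [AlgEquiv.symm_apply_eq, optionEquivLeft_apply, aeval_rename]
    induction c using MvPolynomial.induction_on with
    | C a => simp
    | add p q hp hq => simp [← hp, ← hq]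
    | mul_X p n hp => simp [← hp]
  simp only [auxEmb, AlgHom.comp_apply]
  erw [this]
  rw [rename_rename]
  rfl

lemma auxEmb_X : auxEmb k N Polynomial.X = X N := by
  have : (optionEquivLeft k (Fin N)).symm Polynomial.X = X none := by
    simp
  simp only [auxEmb, AlgHom.comp_apply]
  erw [this]
  simp [auxIdx]

lemma auxEmb_injective : Function.Injective (auxEmb k N) :=
  (rename_injective _ (auxIdx_injective N)).comp (optionEquivLeft k (Fin N)).symm.injective

lemma auxEmb_isUnit (p : Polynomial (MvPolynomial (Fin N) k)) (h : IsUnit (auxEmb k N p)) :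
    IsUnit p := by
  have h1 := h.map (killCompl (R := k) (auxIdx_injective N))
  simp only [auxEmb, AlgHom.comp_apply, killCompl_rename_app] at h1
  have h2 := h1.map (optionEquivLeft k (Fin N))
  have h3 : (optionEquivLeft k (Fin N)) ((optionEquivLeft k (Fin N)).symm p) = p := by simp
  erw [h3] at h2
  exact h2

lemma auxEmb_surj (Q : MvPolynomial ℕ k) (hQ : ∀ m ∈ Q.vars, m ≤ N) :
    ∃ q, auxEmb k N q = Q := by
  have : (Q.vars : Set ℕ) ⊆ Set.range (auxIdx N) := by
    intro m hm
    rcases (hQ m hm).lt_or_eq with h | h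
    · exact ⟨some ⟨m, h⟩, rfl⟩
    · exact ⟨none, h.symm⟩
  obtain ⟨q, hq⟩ := exists_rename_eq_of_vars_subset_range Q (auxIdx N) (auxIdx_injective N) this
  refine ⟨optionEquivLeft k (Fin N) q, ?_⟩
  rw [← hq]
  have h3 : (optionEquivLeft k (Fin N)).symm ((optionEquivLeft k (Fin N)) q) = q := by simp
  simp only [auxEmb, AlgHom.comp_apply]
  erw [h3]

lemma auxEmb_C_vars (c : MvPolynomial (Fin N) k) :
    ∀ m ∈ (auxEmb k N (Polynomial.C c)).vars, m < N := by
  classical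
  intro m hm
  rw [auxEmb_C] at hm
  obtain ⟨i, _, rfl⟩ := Finset.mem_image.mp (vars_rename _ _ hm)
  exact i.2

lemma auxEmb_derivative (p : Polynomial (MvPolynomial (Fin N) k)) :
    auxEmb k N (Polynomial.derivative p) = pderiv N (auxEmb k N p) := by
  have hC : ∀ c, pderiv N (auxEmb k N (Polynomial.C c)) = 0 := fun c =>
    pderiv_eq_zero_of_notMem_vars fun h => lt_irrefl _ (auxEmb_C_vars c N h)
  induction p using Polynomial.induction_on' with
  | add p q hp hq => simp [hp, hq]
  | monomial n a =>
    rw [← Polynomial.C_mul_X_pow_eq_monomial, Polynomial.derivative_C_mul_X_pow]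
    simp only [map_mul, map_pow, auxEmb_X, Derivation.leibniz, hC, Derivation.leibniz_pow,
      pderiv_X_self, map_natCast, Polynomial.C_mul]
    simp
    ring

end Embedding

section Reduction

variable {k : Type*} [Field k]

lemma aux_pderiv_mem (M n : ℕ) (Q : MvPolynomial ℕ k) (hQ : Q ∈ supported k (Set.Iic M)) :
    pderiv n Q ∈ supported k (Set.Iic M) := by
  unfold supported at hQ
  induction hQ using Algebra.adjoin_induction with
  | mem x hx =>
    obtain ⟨i, _, rfl⟩ := hx
    rw [pderiv_X]
    by_cases h : n = i
    · subst h; simp [one_mem]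
    · rw [Pi.single_eq_of_ne (by first | exact h | exact Ne.symm h)]; exact zero_mem _
  | algebraMap r => simp [algebraMap_eq, zero_mem]
  | add x y _ _ hx hy => rw [map_add]; exact add_mem hx hy
  | mul x y hx' hy' hx hy =>
    rw [Derivation.leibniz]
    exact add_mem (mul_mem hx' hy) (mul_mem hy' hx)

lemma aux_supp_mono {M M' : ℕ} (h : M ≤ M') {Q : MvPolynomial ℕ k}
    (hQ : Q ∈ supported k (Set.Iic M)) : Q ∈ supported k (Set.Iic M') :=
  supported_mono (Set.Iic_subset_Iic.mpr h) hQ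

lemma aux_X_mem {i M : ℕ} (h : i ≤ M) : (X i : MvPolynomial ℕ k) ∈ supported k (Set.Iic M) :=
  Algebra.subset_adjoin ⟨i, h, rfl⟩

lemma aux_D_sub (δ : k → k) (D : MvPolynomial ℕ k → MvPolynomial ℕ k)
    (hDadd : ∀ p q, D (p + q) = D p + D q)
    (hDmul : ∀ p q, D (p * q) = p * D q + q * D p)
    (hDC : ∀ a : k, D (C a) = C (δ a))
    (hDX : ∀ n : ℕ, D (X n) = X (n + 1)) (M : ℕ) (Q : MvPolynomial ℕ k)
    (hQ : Q ∈ supported k (Set.Iic M)) :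
    D Q - pderiv M Q * X (M + 1) ∈ supported k (Set.Iic M) := by
  unfold supported at hQ
  induction hQ using Algebra.adjoin_induction with
  | mem x hx =>
    obtain ⟨i, hi, rfl⟩ := hx
    have hi' : i ≤ M := hi
    by_cases h : i = M
    · subst h; simp [hDX, zero_mem]
    · rw [hDX, pderiv_X_of_ne h, zero_mul, sub_zero]
      exact aux_X_mem (by omega)
  | algebraMap r =>
    rw [algebraMap_eq, hDC, pderiv_C, zero_mul, sub_zero]
    exact Subalgebra.algebraMap_mem _ _
  | add x y _ _ hx hy =>
    have := add_mem hx hy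
    convert this using 1
    rw [hDadd, map_add]; ring
  | mul x y hx' hy' hx hy =>
    have : _ ∈ supported k (Set.Iic M) := add_mem (mul_mem hx' hy) (mul_mem hy' hx)
    convert this using 1
    rw [hDmul, Derivation.leibniz]
    simp only [smul_eq_mul]; ring

lemma aux_D_mem (δ : k → k) (D : MvPolynomial ℕ k → MvPolynomial ℕ k)
    (hDadd : ∀ p q, D (p + q) = D p + D q)
    (hDmul : ∀ p q, D (p * q) = p * D q + q * D p)
    (hDC : ∀ a : k, D (C a) = C (δ a))
    (hDX : ∀ n : ℕ, D (X n) = X (n + 1)) (M : ℕ) (Q : MvPolynomial ℕ k)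
    (hQ : Q ∈ supported k (Set.Iic M)) : D Q ∈ supported k (Set.Iic (M + 1)) := by
  have h1 := aux_supp_mono (Nat.le_succ M) (aux_D_sub δ D hDadd hDmul hDC hDX M Q hQ)
  have h2 := aux_supp_mono (Nat.le_succ M) (aux_pderiv_mem M M Q hQ)
  have := add_mem h1 (mul_mem h2 (aux_X_mem (k := k) (le_refl (M + 1))))
  simpa using this

lemma aux_iter (δ : k → k) (D : MvPolynomial ℕ k → MvPolynomial ℕ k)
    (hDadd : ∀ p q, D (p + q) = D p + D q)
    (hDmul : ∀ p q, D (p * q) = p * D q + q * D p)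
    (hDC : ∀ a : k, D (C a) = C (δ a))
    (hDX : ∀ n : ℕ, D (X n) = X (n + 1)) (N : ℕ) (P : MvPolynomial ℕ k)
    (hP : P ∈ supported k (Set.Iic N)) (j : ℕ) :
    ∃ R ∈ supported k (Set.Iic (N + j)),
      D^[j + 1] P = pderiv N P * X (N + j + 1) + R := by
  induction j with
  | zero =>
    exact ⟨_, aux_D_sub δ D hDadd hDmul hDC hDX N P hP, by simp⟩
  | succ j ih =>
    obtain ⟨R, hR, h⟩ := ih
    refine ⟨X (N + j + 1) * D (pderiv N P) + D R, ?_, ?_⟩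
    · have hS := aux_D_mem δ D hDadd hDmul hDC hDX _ _ (aux_pderiv_mem N N P hP)
      exact add_mem (mul_mem (aux_X_mem (by omega)) (aux_supp_mono (by omega) hS))
        (aux_D_mem δ D hDadd hDmul hDC hDX _ _ hR)
    · rw [Function.iterate_succ_apply', h, hDadd, hDmul, hDX]
      simp only [← add_assoc]

/-- The subalgebra of elements that reduce to an element of order at most `N`. -/
def auxRed (U : Subalgebra k (MvPolynomial ℕ k)) (S : MvPolynomial ℕ k) (hS : S ∈ U)
    (I : Ideal (MvPolynomial ℕ k)) : Subalgebra k (MvPolynomial ℕ k) where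
  carrier := {Q | ∃ m : ℕ, ∃ Q0 ∈ U, S ^ m * Q - Q0 ∈ I}
  mul_mem' := by
    rintro a b ⟨m, a0, ha0, ha⟩ ⟨n, b0, hb0, hb⟩
    refine ⟨m + n, a0 * b0, mul_mem ha0 hb0, ?_⟩
    have := I.add_mem (I.mul_mem_left (S ^ n * b) ha) (I.mul_mem_left a0 hb)
    convert this using 1
    ring
  add_mem' := by
    rintro a b ⟨m, a0, ha0, ha⟩ ⟨n, b0, hb0, hb⟩
    refine ⟨m + n, S ^ n * a0 + S ^ m * b0,
      add_mem (mul_mem (pow_mem hS _) ha0) (mul_mem (pow_mem hS _) hb0), ?_⟩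
    have := I.add_mem (I.mul_mem_left (S ^ n) ha) (I.mul_mem_left (S ^ m) hb)
    convert this using 1
    ring
  algebraMap_mem' r := ⟨0, _, U.algebraMap_mem r, by simp⟩

lemma aux_reduce (δ : k → k) (D : MvPolynomial ℕ k → MvPolynomial ℕ k)
    (hDadd : ∀ p q, D (p + q) = D p + D q)
    (hDmul : ∀ p q, D (p * q) = p * D q + q * D p)
    (hDC : ∀ a : k, D (C a) = C (δ a))
    (hDX : ∀ n : ℕ, D (X n) = X (n + 1)) (N : ℕ) (P : MvPolynomial ℕ k)
    (hP : P ∈ supported k (Set.Iic N)) (I : Ideal (MvPolynomial ℕ k))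
    (hI : ∀ j, D^[j] P ∈ I) (Q : MvPolynomial ℕ k) :
    ∃ m : ℕ, ∃ Q0 ∈ supported k (Set.Iic N), pderiv N P ^ m * Q - Q0 ∈ I := by
  set T := auxRed (supported k (Set.Iic N)) (pderiv N P) (aux_pderiv_mem N N P hP) I with hT
  have hX : ∀ n : ℕ, X n ∈ T := by
    intro n
    induction n using Nat.strong_induction_on with
    | _ n ih =>
      by_cases hn : n ≤ N
      · exact ⟨0, X n, aux_X_mem hn, by simp⟩
      obtain ⟨j, rfl⟩ : ∃ j, n = N + j + 1 := ⟨n - N - 1, by omega⟩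
      obtain ⟨R, hR, h⟩ := aux_iter δ D hDadd hDmul hDC hDX N P hP j
      have hRT : R ∈ T := by
        refine (Algebra.adjoin_le ?_ : supported k (Set.Iic (N + j)) ≤ T) hR
        rintro _ ⟨i, hi, rfl⟩
        have hi' : i ≤ N + j := hi
        exact ih i (by omega)
      obtain ⟨m, R0, hR0, hm⟩ := hRT
      refine ⟨m + 1, -R0, neg_mem hR0, ?_⟩
      have h1 := hI (j + 1)
      rw [h] at h1
      have := I.sub_mem (I.mul_mem_left (pderiv N P ^ m) h1) hm
      convert this using 1
      ring
  have hQ : Q ∈ T := by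
    induction Q using MvPolynomial.induction_on with
    | C a => exact T.algebraMap_mem a
    | add p q hp hq => exact add_mem hp hq
    | mul_X p n hp => exact mul_mem hp (hX n)
  exact hQ

end Reduction

/-- For an irreducible differential polynomial `P` of order `N ≥ 0` in the
differential polynomial ring `k{x}` (modelled as `MvPolynomial ℕ k`, where the variable
`n` stands for `x^(n)`, with derivation `D` extending the derivation `δ` of `k` and
sending `x^(n)` to `x^(n+1)`), every prime differential ideal of `k{x}` that contains
`P` and is distinct from `I(P) = {Q | ∃ m, S_P ^ m * Q ∈ ⟨P⟩}` (where `S_P = ∂P/∂x^(N)`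
is the separant of `P` and `⟨P⟩` is the smallest differential ideal containing `P`,
i.e. the ideal spanned by the iterated derivatives of `P`) contains a nonzero element
of order strictly less than `N`. -/
theorem prime_differential_ideal_ne_separant_saturation_contains_lower_order
    {k : Type*} [Field k] [CharZero k]
    (δ : k → k)
    (hδadd : ∀ x y, δ (x + y) = δ x + δ y)
    (hδmul : ∀ x y, δ (x * y) = x * δ y + y * δ x)
    (D : MvPolynomial ℕ k → MvPolynomial ℕ k)
    (hDadd : ∀ p q, D (p + q) = D p + D q)
    (hDmul : ∀ p q, D (p * q) = p * D q + q * D p)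
    (hDC : ∀ a : k, D (C a) = C (δ a))
    (hDX : ∀ n : ℕ, D (X n) = X (n + 1))
    (P : MvPolynomial ℕ k) (hPirr : Irreducible P)
    (N : ℕ) (hord : N ∈ P.vars) (hordmax : ∀ m ∈ P.vars, m ≤ N)
    (J : Ideal (MvPolynomial ℕ k)) (hJprime : J.IsPrime)
    (hJdiff : ∀ Q ∈ J, D Q ∈ J) (hPJ : P ∈ J)
    (hJne : (J : Set (MvPolynomial ℕ k)) ≠
      {Q | ∃ m : ℕ, (pderiv N P) ^ m * Q ∈ Ideal.span {R | ∃ j : ℕ, R = D^[j] P}}) :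
    ∃ Q ∈ J, Q ≠ 0 ∧ ∀ m ∈ Q.vars, m < N := by
  classical
  by_contra hcon
  push Not at hcon
  apply hJne
  set I := Ideal.span {R | ∃ j : ℕ, R = D^[j] P} with hIdef
  have hI : ∀ j, D^[j] P ∈ I := fun j => Ideal.subset_span ⟨j, rfl⟩
  have hIJ : I ≤ J := by
    rw [hIdef, Ideal.span_le]
    rintro _ ⟨j, rfl⟩
    induction j with
    | zero => exact hPJ
    | succ j ih => rw [Function.iterate_succ_apply']; exact hJdiff _ ih
  have hPsupp : P ∈ supported k (Set.Iic N) := by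
    rw [mem_supported]; exact fun m hm => hordmax m hm
  obtain ⟨p, hp⟩ := auxEmb_surj P hordmax
  set J' : Ideal (Polynomial (MvPolynomial (Fin N) k)) := J.comap (auxEmb k N) with hJ'
  have h0 : ∀ c, Polynomial.C c ∈ J' → c = 0 := by
    intro c hc
    by_contra hc0
    have hne : auxEmb k N (Polynomial.C c) ≠ 0 := by
      intro h
      rw [← map_zero (auxEmb k N)] at h
      exact hc0 (Polynomial.C_eq_zero.mp (auxEmb_injective h))
    obtain ⟨m, hm, hmN⟩ := hcon _ hc hne
    have := auxEmb_C_vars c m hm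
    omega
  have hpirr : Irreducible p := by
    refine ⟨fun h => hPirr.not_isUnit (hp ▸ h.map (auxEmb k N)), ?_⟩
    intro a b hab
    have h : P = auxEmb k N a * auxEmb k N b := by rw [← hp, hab, map_mul]
    exact (hPirr.isUnit_or_isUnit h).imp (auxEmb_isUnit a) (auxEmb_isUnit b)
  have hpJ : p ∈ J' := by rw [hJ', Ideal.mem_comap, hp]; exact hPJ
  have hdvd := aux_dvd_of_mem J' h0 p hpirr.prime hpJ
  have hS : pderiv N P ∉ J := by
    intro h
    rw [← hp, ← auxEmb_derivative] at h
    have hd := hdvd _ h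
    have hder : Polynomial.derivative p = 0 := by
      by_contra hne
      have h1 := Polynomial.degree_le_of_dvd hd hne
      exact absurd (Polynomial.degree_derivative_lt hpirr.ne_zero) (not_lt.mpr h1)
    have hc := Polynomial.eq_C_of_derivative_eq_zero hder
    rw [hc] at hp
    rw [← hp] at hord
    exact lt_irrefl _ (auxEmb_C_vars _ N hord)
  ext Q
  constructor
  · intro hQ
    obtain ⟨m, Q0, hQ0, hm⟩ := aux_reduce δ D hDadd hDmul hDC hDX N P hPsupp I hI Q
    have hQ0J : Q0 ∈ J := by
      have := J.sub_mem (J.mul_mem_left (pderiv N P ^ m) hQ) (hIJ hm)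
      simpa using this
    rw [mem_supported] at hQ0
    obtain ⟨q, hq⟩ := auxEmb_surj Q0 (fun m hm => hQ0 hm)
    have hPQ : P ∣ Q0 := by
      rw [← hp, ← hq]
      exact map_dvd (auxEmb k N) (hdvd q (by rw [hJ', Ideal.mem_comap, hq]; exact hQ0J))
    have hQ0I : Q0 ∈ I := I.mem_of_dvd hPQ (hI 0)
    exact ⟨m, by simpa using I.add_mem hm hQ0I⟩
  · rintro ⟨m, hm⟩
    rcases hJprime.mem_or_mem (hIJ hm) with h | h
    · exact absurd (hJprime.mem_of_pow_mem _ h) hS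
    · exact h
end

section
/- Let K be a differential field of characteristic zero whose field of constants C is algebraically closed, and fix a linear homogeneous differential equation y^(n) + a₁ y^(n−1) + … + aₙ y = 0 with coefficients in K. Any two Picard–Vessiot extensions of K for this equation are isomorphic over K as differential fields: there is a field isomorphism between them that fixes K pointwise and commutes with the derivations. -/
open scoped TensorProduct


theorem pv_linInd {C M T ι : Type*} [Field C] [Field M] [CommRing T] [Algebra C M] [Algebra M T]
    [Algebra C T] [IsScalarTower C M T] (δ : M →+ M) (D : T →+ T)
    (hDm : ∀ x y, D (x * y) = x * D y + y * D x)
    (hD : ∀ m, D (algebraMap M T m) = algebraMap M T (δ m))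
    (hC : ∀ m, δ m = 0 → m ∈ (algebraMap C M).range)
    (b : ι → T) (hb : LinearIndependent C b) (hbc : ∀ i, D (b i) = 0) :
    LinearIndependent M b := by
  classical
  rw [linearIndependent_iff']
  intro s
  induction s using Finset.induction_on with
  | empty => simp
  | insert j s hj ih =>
    intro m hm
    by_cases h0 : m j = 0
    · rw [Finset.sum_insert hj, h0, zero_smul, zero_add] at hm
      intro i hi
      rcases Finset.mem_insert.1 hi with rfl | hi
      · exact h0
      · exact ih m hm i hi
    · exfalso
      have hm1 : b j + ∑ i ∈ s, ((m j)⁻¹ * m i) • b i = 0 := by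
        have := congrArg (fun t => (m j)⁻¹ • t) hm
        simp only [Finset.sum_insert hj, smul_add, smul_zero, Finset.smul_sum, smul_smul,
          inv_mul_cancel₀ h0, one_smul] at this
        exact this
      have hd : ∑ i ∈ s, (δ ((m j)⁻¹ * m i)) • b i = 0 := by
        have := congrArg D hm1
        rw [map_add, hbc, zero_add, map_zero, map_sum] at this
        rw [← this]
        refine Finset.sum_congr rfl fun i _ => ?_
        rw [Algebra.smul_def, Algebra.smul_def, hDm, hbc, hD, mul_zero, zero_add, mul_comm]
      have hd0 := ih _ hd
      choose! c hc using fun i (hi : i ∈ s) => hC _ (hd0 i hi)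
      have hm2 : ∑ i ∈ insert j s, (if i = j then 1 else c i) • b i = 0 := by
        rw [Finset.sum_insert hj, if_pos rfl, one_smul, ← hm1]
        congr 1
        refine Finset.sum_congr rfl fun i hi => ?_
        rw [if_neg (by rintro rfl; exact hj hi), ← hc i hi, algebraMap_smul]
      have := (linearIndependent_iff'.1 hb) _ _ hm2 j (Finset.mem_insert_self _ _)
      simp at this

theorem pv_point {C B : Type*} [Field C] [IsAlgClosed C] [CommRing B] [Nontrivial B] [Algebra C B]
    [Algebra.FiniteType C B] : Nonempty (B →ₐ[C] C) := by
  obtain ⟨m, hm⟩ := Ideal.exists_maximal B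
  let _ : Field (B ⧸ m) := Ideal.Quotient.field m
  have : Module.Finite C (B ⧸ m) := finite_of_finite_type_of_isJacobsonRing C (B ⧸ m)
  have hb := IsAlgClosed.algebraMap_bijective_of_isIntegral (k := C) (K := B ⧸ m)
  exact ⟨(AlgEquiv.ofBijective (Algebra.ofId C (B ⧸ m)) hb).symm.toAlgHom.comp
    (Ideal.Quotient.mkₐ C m)⟩

theorem pv_lemA {C M T n : Type*} [Field C] [IsAlgClosed C] [Field M] [CommRing T] [Nontrivial T]
    [Fintype n] [DecidableEq n]
    [Algebra C M] [Algebra M T]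
    [Algebra C T] [IsScalarTower C M T] (δ : M →+ M) (D : T →+ T)
    (hDm : ∀ x y, D (x * y) = x * D y + y * D x)
    (hD : ∀ m, D (algebraMap M T m) = algebraMap M T (δ m))
    (hC : ∀ m, δ m = 0 ↔ m ∈ (algebraMap C M).range)
    (Z Z' : Matrix n n T) (hZ : ∀ i j, D (Z i j) = 0) (hZ' : ∀ i j, D (Z' i j) = 0)
    (hZZ : Z * Z' = 1) :
    ∃ A A' : Matrix n n C, A * A' = 1 ∧ ∀ p : MvPolynomial (n × n) M,
      MvPolynomial.aeval (fun x => Z x.1 x.2) p = 0 →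
      MvPolynomial.aeval (fun x => algebraMap C M (A x.1 x.2)) p = 0 := by
  classical
  let S : Set T := Set.range (fun x : n × n => Z x.1 x.2) ∪ Set.range (fun x : n × n => Z' x.1 x.2)
  let B := Algebra.adjoin C S
  have hBft : Algebra.FiniteType C B := by
    have hS : S.Finite := (Set.finite_range _).union (Set.finite_range _)
    rw [← Subalgebra.fg_iff_finiteType]
    exact ⟨hS.toFinset, by rw [hS.coe_toFinset]⟩
  have hBc : ∀ t ∈ B, D t = 0 := by
    intro t ht
    induction ht using Algebra.adjoin_induction with
    | mem x hx =>
      rcases hx with ⟨y, rfl⟩ | ⟨y, rfl⟩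
      · exact hZ _ _
      · exact hZ' _ _
    | algebraMap r =>
      rw [IsScalarTower.algebraMap_apply C M T, hD, (hC _).2 ⟨r, rfl⟩, map_zero]
    | add x y _ _ hx hy => rw [map_add, hx, hy, add_zero]
    | mul x y _ _ hx hy => rw [hDm, hx, hy]; simp
  obtain ⟨χ⟩ := pv_point (C := C) (B := B)
  have hzB : ∀ i j, Z i j ∈ B := fun i j => Algebra.subset_adjoin (Or.inl ⟨(i, j), rfl⟩)
  have hzB' : ∀ i j, Z' i j ∈ B := fun i j => Algebra.subset_adjoin (Or.inr ⟨(i, j), rfl⟩)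
  let ZB : Matrix n n B := fun i j => ⟨Z i j, hzB i j⟩
  let ZB' : Matrix n n B := fun i j => ⟨Z' i j, hzB' i j⟩
  have hZB : ZB * ZB' = 1 := by
    ext i j
    have := congrFun (congrFun hZZ i) j
    simp only [Matrix.mul_apply, Matrix.one_apply] at this ⊢
    rw [apply_ite (Subtype.val : B → T)]
    simpa [ZB, ZB'] using this
  refine ⟨ZB.map χ, ZB'.map χ, ?_, ?_⟩
  · rw [← Matrix.map_mul, hZB, Matrix.map_one _ (map_zero χ) (map_one χ)]
  · intro p hp
    let Θ : M ⊗[C] B →ₐ[M] T := Algebra.TensorProduct.lift (Algebra.ofId M T) B.val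
      (fun _ _ => mul_comm _ _)
    let X : M ⊗[C] B →ₐ[M] M := Algebra.TensorProduct.lift (AlgHom.id M M)
      ((Algebra.ofId C M).comp χ) (fun _ _ => mul_comm _ _)
    have hΘ1 : ∀ t : B, Θ (1 ⊗ₜ t) = t := fun t => by
      
      refine (Algebra.TensorProduct.lift_tmul _ _ _ _ _).trans ?_
      rw [map_one, one_mul]; rfl
    have hX1 : ∀ t : B, X (1 ⊗ₜ t) = algebraMap C M (χ t) := fun t => by
      
      refine (Algebra.TensorProduct.lift_tmul _ _ _ _ _).trans ?_
      rw [map_one, one_mul]; rfl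
    have hΘ : Function.Injective Θ := by
      let b := Module.Basis.ofVectorSpace C B
      have hli : LinearIndependent M (fun i => (b i : T)) := by
        refine pv_linInd δ D hDm hD (fun m => (hC m).1) _ ?_ (fun i => hBc _ (b i).2)
        exact b.linearIndependent.map' B.val.toLinearMap
          (LinearMap.ker_eq_bot.2 Subtype.val_injective)
      let b' := Algebra.TensorProduct.basis M b
      rw [injective_iff_map_eq_zero]
      intro x hx
      rw [← b'.linearCombination_repr x] at hx ⊢
      have h2 : Finsupp.linearCombination M (fun i => (b i : T)) (b'.repr x) = 0 := by
        rw [← hx, ← AlgHom.toLinearMap_apply, Finsupp.apply_linearCombination]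
        congr 2
        ext i
        simp only [b', Function.comp_apply, AlgHom.toLinearMap_apply,
          Algebra.TensorProduct.basis_apply, hΘ1]
      rw [linearIndependent_iff.1 hli _ h2, map_zero]
    have key : MvPolynomial.aeval (fun x : n × n => (1 : M) ⊗ₜ[C] ZB x.1 x.2) p = 0 := by
      apply hΘ
      rw [map_zero, ← hp, ← AlgHom.comp_apply, MvPolynomial.comp_aeval]
      simp only [hΘ1, ZB]
    have := congrArg X key
    rw [map_zero, ← AlgHom.comp_apply, MvPolynomial.comp_aeval] at this
    simpa only [hX1, Matrix.map_apply] using this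

theorem pv_tensorDer {K M N : Type*} [Field K] [Field M] [Field N] [Algebra K M] [Algebra K N]
    (δK : K → K) (δ : M →+ M) (ε : N →+ N)
    (hδm : ∀ x y, δ (x * y) = x * δ y + y * δ x)
    (hεm : ∀ x y, ε (x * y) = x * ε y + y * ε x)
    (hδ : ∀ c, δ (algebraMap K M c) = algebraMap K M (δK c))
    (hε : ∀ c, ε (algebraMap K N c) = algebraMap K N (δK c)) :
    ∃ D : (M ⊗[K] N) →+ (M ⊗[K] N), (∀ m n, D (m ⊗ₜ n) = δ m ⊗ₜ n + m ⊗ₜ ε n) ∧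
      ∀ x y, D (x * y) = x * D y + y * D x := by
  let f : M →+ N →+ M ⊗[K] N := AddMonoidHom.mk' (fun m => AddMonoidHom.mk'
      (fun n => δ m ⊗ₜ n + m ⊗ₜ ε n) (by
        intro a b; simp only [map_add, TensorProduct.tmul_add]; abel)) (by
        intro a b; ext n
        simp only [map_add, TensorProduct.add_tmul, AddMonoidHom.mk'_apply, AddMonoidHom.add_apply]
        abel)
  have hδs : ∀ (r : K) m, δ (r • m) = r • δ m + δK r • m := fun r m => by
    simp only [Algebra.smul_def, hδm, hδ]; ring
  have hεs : ∀ (r : K) m, ε (r • m) = r • ε m + δK r • m := fun r m => by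
    simp only [Algebra.smul_def, hεm, hε]; ring
  let F : M ⊗[K] N →+ M ⊗[K] N := TensorProduct.liftAddHom f (by
    intro r m n
    simp only [f, AddMonoidHom.mk'_apply, hδs, hεs, TensorProduct.add_tmul, TensorProduct.tmul_add,
      TensorProduct.smul_tmul]
    abel)
  have hF : ∀ m n, F (m ⊗ₜ n) = δ m ⊗ₜ n + m ⊗ₜ ε n := fun m n => by
    simp [F, f]
  refine ⟨F, hF, ?_⟩
  intro x y
  induction x using TensorProduct.induction_on with
  | zero => simp
  | add a b ha hb => simp only [add_mul, map_add, ha, hb, mul_add]; abel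
  | tmul m n =>
    induction y using TensorProduct.induction_on with
    | zero => simp
    | add a b ha hb => simp only [add_mul, map_add, ha, hb, mul_add]; abel
    | tmul m' n' =>
      simp only [Algebra.TensorProduct.tmul_mul_tmul, hF, hδm, hεm, mul_add,
        TensorProduct.add_tmul, TensorProduct.tmul_add]
      rw [mul_comm m' m, mul_comm n' n]
      abel

theorem pv_const {T n : Type*} [CommRing T] [Fintype n] [DecidableEq n] (D : T →+ T)
    (hDm : ∀ x y, D (x * y) = x * D y + y * D x) (H P P' Q Z : Matrix n n T)
    (hP : P.map D = H * P) (hQ : Q.map D = H * Q) (hPP : P' * P = 1) (hZ : P * Z = Q) :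
    ∀ i j, D (Z i j) = 0 := by
  have h1 : (P * Z).map D = P.map D * Z + P * Z.map D := by
    ext i j
    simp only [Matrix.map_apply, Matrix.mul_apply, Matrix.add_apply, map_sum, hDm,
      Finset.sum_add_distrib]
    rw [add_comm]
    congr 1
    exact Finset.sum_congr rfl fun _ _ => mul_comm _ _
  rw [hZ, hQ, hP, Matrix.mul_assoc, hZ] at h1
  have h2 : P * Z.map D = 0 := by simpa using h1.symm
  have h3 : Z.map D = 0 := by
    rw [← Matrix.one_mul (Z.map D), ← hPP, Matrix.mul_assoc, h2, Matrix.mul_zero]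
  intro i j
  exact congrFun (congrFun h3 i) j

theorem pv_lemB {C K M N n : Type*} [Field C] [IsAlgClosed C] [Field K] [Field M] [Field N]
    [Fintype n] [DecidableEq n] [Algebra C K] [Algebra K M] [Algebra K N] [Algebra C M]
    [IsScalarTower C K M]
    (δK : K → K) (δ : M →+ M) (ε : N →+ N)
    (hδm : ∀ x y, δ (x * y) = x * δ y + y * δ x)
    (hεm : ∀ x y, ε (x * y) = x * ε y + y * ε x)
    (hδ : ∀ c, δ (algebraMap K M c) = algebraMap K M (δK c))
    (hε : ∀ c, ε (algebraMap K N c) = algebraMap K N (δK c))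
    (hC : ∀ m, δ m = 0 ↔ m ∈ (algebraMap C M).range)
    (H : Matrix n n K) (U : Matrix n n M) (V : Matrix n n N)
    (hU : U.map δ = H.map (algebraMap K M) * U) (hV : V.map ε = H.map (algebraMap K N) * V)
    (hU0 : U.det ≠ 0) (hV0 : V.det ≠ 0) :
    ∃ A A' : Matrix n n C, A * A' = 1 ∧ ∀ p : MvPolynomial (n × n) K,
      MvPolynomial.aeval (fun x => V x.1 x.2) p = 0 →
      MvPolynomial.aeval (fun x => (U * A.map (algebraMap C M)) x.1 x.2) p = 0 := by
  obtain ⟨D, hD, hDm⟩ := pv_tensorDer δK δ ε hδm hεm hδ hε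
  have hδ1 : δ 1 = 0 := by simpa using hδm 1 1
  have hε1 : ε 1 = 0 := by simpa using hεm 1 1
  let l : M →ₐ[K] M ⊗[K] N := Algebra.TensorProduct.includeLeft
  let r : N →ₐ[K] M ⊗[K] N := Algebra.TensorProduct.includeRight
  have hl : ∀ m, D (l m) = l (δ m) := fun m => by
    simp [l, hD, hε1]
  have hr : ∀ m, D (r m) = r (ε m) := fun m => by
    simp [r, hD, hδ1]
  have hUu : IsUnit U.det := hU0.isUnit
  have hVu : IsUnit V.det := hV0.isUnit
  let H' : Matrix n n (M ⊗[K] N) := H.map (algebraMap K _)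
  have hlU : (U.map l).map D = H' * U.map l := by
    have h1 : (U.map l).map D = (U.map δ).map l := by ext i j; simp [hl]
    rw [h1, hU, Matrix.map_mul]
    have h2 : (H.map (algebraMap K M)).map l = H' := by ext i j; simp [H']
    rw [h2]
  have hrV : (V.map r).map D = H' * V.map r := by
    have h1 : (V.map r).map D = (V.map ε).map r := by ext i j; simp [hr]
    rw [h1, hV, Matrix.map_mul]
    have h2 : (H.map (algebraMap K N)).map r = H' := by
      ext i j
      simp only [H', Matrix.map_apply, AlgHom.commutes]
    rw [h2]
  have m1 : ∀ {S : Type _} [CommRing S] [Algebra K S] (f : S →ₐ[K] M ⊗[K] N) (X Y : Matrix n n S),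
      X * Y = 1 → X.map f * Y.map f = 1 := by
    intro S _ _ f X Y h
    rw [← Matrix.map_mul, h, Matrix.map_one _ (map_zero f) (map_one f)]
  have a1 := m1 l _ _ (Matrix.mul_nonsing_inv U hUu)
  have a2 := m1 l _ _ (Matrix.nonsing_inv_mul U hUu)
  have b1 : V.map r * V⁻¹.map r = 1 := by
    rw [← Matrix.map_mul, Matrix.mul_nonsing_inv V hVu, Matrix.map_one _ (map_zero r) (map_one r)]
  have b2 : V⁻¹.map r * V.map r = 1 := by
    rw [← Matrix.map_mul, Matrix.nonsing_inv_mul V hVu, Matrix.map_one _ (map_zero r) (map_one r)]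
  have hz : U.map l * (U⁻¹.map l * V.map r) = V.map r := by
    rw [← Matrix.mul_assoc, a1, Matrix.one_mul]
  have hz' : V.map r * (V⁻¹.map r * U.map l) = U.map l := by
    rw [← Matrix.mul_assoc, b1, Matrix.one_mul]
  obtain ⟨A, A', hA, h⟩ := pv_lemA δ D hDm (fun m => hl m) hC (U⁻¹.map l * V.map r)
    (V⁻¹.map r * U.map l)
    (pv_const D hDm H' _ _ _ _ hlU hrV a2 hz) (pv_const D hDm H' _ _ _ _ hrV hlU b2 hz')
    (by rw [Matrix.mul_assoc, hz', a2])
  refine ⟨A, A', hA, fun p hp => ?_⟩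
  let q : MvPolynomial (n × n) M := MvPolynomial.aeval
    (fun x : n × n => ∑ k, MvPolynomial.C (U x.1 k) * MvPolynomial.X (k, x.2)) p
  have hq := h q ?_
  · simp only [q] at hq
    rw [← AlgHom.restrictScalars_apply K, ← AlgHom.comp_apply, MvPolynomial.comp_aeval] at hq
    rw [← hq]
    congr 2
    ext x
    simp [Matrix.mul_apply]
  · simp only [q]
    rw [← AlgHom.restrictScalars_apply K, ← AlgHom.comp_apply, MvPolynomial.comp_aeval]
    have : r (MvPolynomial.aeval (fun x => V x.1 x.2) p) = 0 := by rw [hp, map_zero]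
    rw [← AlgHom.comp_apply, MvPolynomial.comp_aeval] at this
    rw [← this]
    congr 2
    ext x
    have := congrFun (congrFun hz x.1) x.2
    rw [Matrix.map_apply] at this
    rw [← this, Matrix.mul_apply]
    simp only [AlgHom.restrictScalars_apply, map_sum, map_mul, MvPolynomial.aeval_C,
      MvPolynomial.aeval_X]
    rfl

theorem pv_noeth {R : Type*} [CommRing R] [IsNoetherianRing R] (τ : R →+* R)
    (hτ : Function.Surjective τ) (P : Ideal R) (hP : P ≤ P.comap τ) : P.comap τ = P := by
  let f : ℕ → Ideal R := fun k => (Ideal.comap τ)^[k] P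
  have hf : Monotone f := by
    refine monotone_nat_of_le_succ fun k => ?_
    simp only [f]
    rw [Function.iterate_succ_apply]
    have hm : Monotone (Ideal.comap τ : Ideal R → Ideal R) := fun _ _ h => Ideal.comap_mono h
    exact hm.iterate k hP
  obtain ⟨k, hk⟩ := monotone_stabilizes_iff_noetherian.2 (inferInstance : IsNoetherian R R) ⟨f, hf⟩
  have := hk (k + 1) (Nat.le_succ k)
  change (Ideal.comap τ)^[k] P = (Ideal.comap τ)^[k + 1] P at this
  rw [Function.iterate_succ_apply] at this
  exact ((Ideal.comap_injective_of_surjective τ hτ).iterate k this).symm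

theorem pv_lemC {K M N n : Type*} [Field K] [Field M] [Field N]
    [Fintype n] [DecidableEq n] [Algebra K M] [Algebra K N]
    (U : Matrix n n M) (V : Matrix n n N) (A A' B B' : Matrix n n K)
    (hA : A * A' = 1) (hB : B * B' = 1)
    (h1 : ∀ p : MvPolynomial (n × n) K, MvPolynomial.aeval (fun x => V x.1 x.2) p = 0 →
      MvPolynomial.aeval (fun x => (U * A.map (algebraMap K M)) x.1 x.2) p = 0)
    (h2 : ∀ p : MvPolynomial (n × n) K, MvPolynomial.aeval (fun x => U x.1 x.2) p = 0 →
      MvPolynomial.aeval (fun x => (V * B.map (algebraMap K N)) x.1 x.2) p = 0)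
    (p : MvPolynomial (n × n) K) :
    MvPolynomial.aeval (fun x => V x.1 x.2) p = 0 ↔
      MvPolynomial.aeval (fun x => (U * A.map (algebraMap K M)) x.1 x.2) p = 0 := by
  refine ⟨h1 p, fun hp => ?_⟩
  let σ : Matrix n n K → MvPolynomial (n × n) K →ₐ[K] MvPolynomial (n × n) K := fun A =>
    MvPolynomial.aeval (fun x => ∑ k, MvPolynomial.X (x.1, k) * MvPolynomial.C (A k x.2))
  have hσU : ∀ (A : Matrix n n K) p, MvPolynomial.aeval (fun x => U x.1 x.2) (σ A p) =
      MvPolynomial.aeval (fun x => (U * A.map (algebraMap K M)) x.1 x.2) p := by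
    intro A p
    rw [← AlgHom.comp_apply, MvPolynomial.comp_aeval]
    congr 2
    ext x
    simp [Matrix.mul_apply]
  have hσV : ∀ (A : Matrix n n K) p, MvPolynomial.aeval (fun x => V x.1 x.2) (σ A p) =
      MvPolynomial.aeval (fun x => (V * A.map (algebraMap K N)) x.1 x.2) p := by
    intro A p
    rw [← AlgHom.comp_apply, MvPolynomial.comp_aeval]
    congr 2
    ext x
    simp [Matrix.mul_apply]
  have hσσ : ∀ A B : Matrix n n K, A * B = 1 → ∀ p, σ A (σ B p) = p := by
    intro A B h p
    have : (σ A).comp (σ B) = AlgHom.id K _ := by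
      refine MvPolynomial.algHom_ext fun x => ?_
      have hx := fun i => congrFun (congrFun h i) x.2
      simp only [Matrix.mul_apply] at hx
      simp only [σ, AlgHom.comp_apply, MvPolynomial.aeval_X, map_sum, map_mul, MvPolynomial.aeval_C,
        AlgHom.id_apply, MvPolynomial.algebraMap_eq]
      simp only [Finset.sum_mul]
      rw [Finset.sum_comm]
      simp only [mul_assoc, ← Finset.mul_sum, ← map_mul, ← map_sum, hx]
      simp [Matrix.one_apply]
    exact DFunLike.congr_fun this p
  let P := RingHom.ker (MvPolynomial.aeval (R := K) (fun x : n × n => V x.1 x.2))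
  let τ := (σ B).comp (σ A)
  have hP : ∀ q, MvPolynomial.aeval (fun x => U x.1 x.2) (σ A q) = 0 →
      τ q ∈ P := by
    intro q hq
    have := h2 _ hq
    rw [← hσV] at this
    exact this
  have hc := pv_noeth τ.toRingHom (fun q => ⟨σ A' (σ B' q), by
    change σ B (σ A (σ A' (σ B' q))) = q
    rw [hσσ A A' hA, hσσ B B' hB]⟩) P (fun q hq => by
      refine hP q ?_
      rw [hσU]
      exact h1 q hq)
  have : p ∈ Ideal.comap τ.toRingHom P := hP p (by rw [hσU]; exact hp)
  rw [hc] at this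
  exact this

theorem pv_frac {K M σ : Type*} [Field K] [Field M] [Algebra K M] (x : σ → M)
    (hx : Subfield.closure (Set.range (algebraMap K M) ∪ Set.range x) = ⊤) (z : M) :
    ∃ p q : MvPolynomial σ K, MvPolynomial.aeval x p / MvPolynomial.aeval x q = z := by
  have hz : z ∈ Subfield.closure (Set.range (algebraMap K M) ∪ Set.range x) := by
    rw [hx]; trivial
  have hle : Subring.closure (Set.range (algebraMap K M) ∪ Set.range x) ≤
      (MvPolynomial.aeval (R := K) x).toRingHom.range := by
    rw [Subring.closure_le]
    rintro _ (⟨c, rfl⟩ | ⟨i, rfl⟩)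
    · exact ⟨MvPolynomial.C c, MvPolynomial.aeval_C _ _⟩
    · exact ⟨MvPolynomial.X i, MvPolynomial.aeval_X _ _⟩
  obtain ⟨a, ha, b, hb, rfl⟩ := Subfield.mem_closure_iff.1 hz
  obtain ⟨p, rfl⟩ := hle ha
  obtain ⟨q, rfl⟩ := hle hb
  exact ⟨p, q, rfl⟩

theorem pv_lemD {K M N σ : Type*} [Field K] [Field M] [Field N] [Algebra K M] [Algebra K N]
    (x : σ → M) (y : σ → N)
    (hx : Subfield.closure (Set.range (algebraMap K M) ∪ Set.range x) = ⊤)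
    (hy : Subfield.closure (Set.range (algebraMap K N) ∪ Set.range y) = ⊤)
    (h : ∀ p : MvPolynomial σ K, MvPolynomial.aeval x p = 0 ↔ MvPolynomial.aeval y p = 0) :
    ∃ e : M ≃+* N, ∀ p : MvPolynomial σ K, e (MvPolynomial.aeval x p) = MvPolynomial.aeval y p := by
  let P := RingHom.ker (MvPolynomial.aeval (R := K) x).toRingHom
  let f : MvPolynomial σ K ⧸ P →+* M := Ideal.Quotient.lift P
    (MvPolynomial.aeval (R := K) x).toRingHom (fun a ha => ha)
  let g : MvPolynomial σ K ⧸ P →+* N := Ideal.Quotient.lift P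
    (MvPolynomial.aeval (R := K) y).toRingHom (fun a ha => (h a).1 ha)
  have hf : Function.Injective f := by
    rw [injective_iff_map_eq_zero]
    intro a ha
    obtain ⟨a, rfl⟩ := Ideal.Quotient.mk_surjective a
    exact Ideal.Quotient.eq_zero_iff_mem.2 ha
  have hg : Function.Injective g := by
    rw [injective_iff_map_eq_zero]
    intro a ha
    obtain ⟨a, rfl⟩ := Ideal.Quotient.mk_surjective a
    exact Ideal.Quotient.eq_zero_iff_mem.2 ((h a).2 ha)
  let _ := f.toAlgebra
  let _ := g.toAlgebra
  have : IsDomain (MvPolynomial σ K ⧸ P) := hf.isDomain f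
  have : FaithfulSMul (MvPolynomial σ K ⧸ P) M := (faithfulSMul_iff_algebraMap_injective _ _).2 hf
  have : FaithfulSMul (MvPolynomial σ K ⧸ P) N := (faithfulSMul_iff_algebraMap_injective _ _).2 hg
  have : IsFractionRing (MvPolynomial σ K ⧸ P) M := IsFractionRing.of_field _ _ fun z => by
    obtain ⟨p, q, hz⟩ := pv_frac x hx z
    exact ⟨Ideal.Quotient.mk P p, Ideal.Quotient.mk P q, hz.symm⟩
  have : IsFractionRing (MvPolynomial σ K ⧸ P) N := IsFractionRing.of_field _ _ fun z => by
    obtain ⟨p, q, hz⟩ := pv_frac y hy z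
    exact ⟨Ideal.Quotient.mk P p, Ideal.Quotient.mk P q, hz.symm⟩
  let e := IsLocalization.algEquiv (nonZeroDivisors (MvPolynomial σ K ⧸ P)) M N
  exact ⟨e.toRingEquiv, fun p => e.commutes (Ideal.Quotient.mk P p)⟩

theorem pv_derInv {M : Type*} [Field M] (δ : M →+ M)
    (hδm : ∀ x y, δ (x * y) = x * δ y + y * δ x) (x : M) : δ x⁻¹ = - (x⁻¹ * x⁻¹ * δ x) := by
  by_cases hx : x = 0
  · simp [hx]
  have hδ1 : δ 1 = 0 := by simpa using hδm 1 1
  have := hδm x x⁻¹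
  rw [mul_inv_cancel₀ hx, hδ1] at this
  field_simp at this ⊢
  linear_combination -this
/-- The derivation of a Picard-Vessiot extension is determined by the companion matrix. -/
theorem pv_companion {K M : Type*} [Field K] [Field M] (ι : K →+* M) (δ : M → M) {n : ℕ}
    (a : Fin n → K) (u : Fin n → M)
    (sol : ∀ i, δ^[n] (u i) + ∑ j : Fin n, ι (a j) * δ^[n - 1 - (j : ℕ)] (u i) = 0) :
    (Matrix.of fun i j : Fin n => δ^[(i : ℕ)] (u j)).map δ =
      (Matrix.of fun i k : Fin n => if (i : ℕ) + 1 < n then (if (k : ℕ) = i + 1 then (1 : K) else 0)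
        else - a k.rev).map ι * (Matrix.of fun i j : Fin n => δ^[(i : ℕ)] (u j)) := by
  ext i j
  simp only [Matrix.map_apply, Matrix.mul_apply, Matrix.of_apply]
  rw [← Function.iterate_succ_apply' δ]
  by_cases hi : (i : ℕ) + 1 < n
  · simp only [if_pos hi]
    rw [Finset.sum_eq_single (⟨i + 1, hi⟩ : Fin n)]
    · simp
    · intro b _ hb
      rw [if_neg (fun h => hb (Fin.ext h))]
      simp
    · simp
  · simp only [if_neg hi]
    have hin : (i : ℕ) + 1 = n := by omega
    have h := sol j
    rw [← Equiv.sum_comp Fin.revPerm] at h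
    rw [Nat.succ_eq_add_one, hin, eq_neg_of_add_eq_zero_left h, ← Finset.sum_neg_distrib]
    refine Finset.sum_congr rfl fun k _ => ?_
    have : n - 1 - (k.rev : ℕ) = k := by rw [Fin.val_rev]; omega
    rw [Fin.revPerm_apply, this, map_neg, neg_mul]

theorem pv_gen {K M n : Type*} [Field K] [Field M] [Algebra K M] [Fintype n] [DecidableEq n]
    (U : Matrix n n M) (A A' : Matrix n n K) (hA : A * A' = 1)
    (hU : Subfield.closure (Set.range (algebraMap K M) ∪ Set.range (fun x : n × n => U x.1 x.2)) = ⊤) :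
    Subfield.closure (Set.range (algebraMap K M) ∪
      Set.range (fun x : n × n => (U * A.map (algebraMap K M)) x.1 x.2)) = ⊤ := by
  rw [eq_top_iff, ← hU, Subfield.closure_le]
  set S := Subfield.closure (Set.range (algebraMap K M) ∪
      Set.range (fun x : n × n => (U * A.map (algebraMap K M)) x.1 x.2))
  have hK : ∀ c, algebraMap K M c ∈ S := fun c => Subfield.subset_closure (Or.inl ⟨c, rfl⟩)
  have hS : ∀ i j, (U * A.map (algebraMap K M)) i j ∈ S :=
    fun i j => Subfield.subset_closure (Or.inr ⟨(i, j), rfl⟩)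
  rintro _ (⟨c, rfl⟩ | ⟨x, rfl⟩)
  · exact hK c
  · have h : U = (U * A.map (algebraMap K M)) * A'.map (algebraMap K M) := by
      rw [Matrix.mul_assoc, ← Matrix.map_mul, hA,
        Matrix.map_one _ (map_zero _) (map_one _), Matrix.mul_one]
    have h' := congrFun (congrFun h x.1) x.2
    rw [Matrix.mul_apply] at h'
    rw [SetLike.mem_coe]
    simp only
    rw [h']
    exact Subfield.sum_mem _ fun k _ => Subfield.mul_mem _ (hS _ _) (hK _)


/-- `IsPicardVessiot δK ι δM a u` says: `M` (with derivation `δM`, extending via the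
embedding `ι` the differential field `K` with derivation `δK`) is a Picard-Vessiot
extension of `K` for the linear homogeneous differential equation
`y^(n) + a 0 * y^(n-1) + ⋯ + a (n-1) * y = 0`, with fundamental system of solutions `u`:
the `u i` are solutions with nonzero Wronskian generating `M` over `K`, and `M` has the
same field of constants as `K`. -/
structure IsPicardVessiot {K M : Type*} [Field K] [Field M]
    (δK : K → K) (ι : K →+* M) (δM : M → M)
    {n : ℕ} (a : Fin n → K) (u : Fin n → M) : Prop where
  der_add : ∀ x y, δM (x + y) = δM x + δM y
  der_mul : ∀ x y, δM (x * y) = x * δM y + y * δM x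
  compat : ∀ c : K, δM (ι c) = ι (δK c)
  sol : ∀ i, δM^[n] (u i) + ∑ j : Fin n, ι (a j) * δM^[n - 1 - (j : ℕ)] (u i) = 0
  wronskian_ne_zero : Matrix.det (Matrix.of fun i j : Fin n => δM^[(i : ℕ)] (u j)) ≠ 0
  generates : Subfield.closure (Set.range ι ∪ Set.range u) = ⊤
  constants : ∀ z : M, δM z = 0 → ∃ c : K, δK c = 0 ∧ ι c = z

/-- Let `K` be a differential field of characteristic zero whose field of
constants is algebraically closed. Any two Picard-Vessiot extensions `M₁`, `M₂` of `K`
for the same linear homogeneous differential equation are isomorphic over `K` as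
differential fields: there is a field isomorphism `M₁ ≃ M₂` fixing `K` pointwise
(i.e. commuting with the embeddings) and commuting with the derivations. -/
theorem picardVessiot_unique
    {K M₁ M₂ : Type*} [Field K] [CharZero K] [Field M₁] [Field M₂]
    (δK : K → K)
    (hadd : ∀ x y, δK (x + y) = δK x + δK y)
    (hmul : ∀ x y, δK (x * y) = x * δK y + y * δK x)
    (halgclosed : ∀ p : Polynomial K, (∀ i, δK (p.coeff i) = 0) → 0 < p.degree →
      ∃ c : K, δK c = 0 ∧ Polynomial.eval c p = 0)
    {n : ℕ} (a : Fin n → K)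
    (ι₁ : K →+* M₁) (δ₁ : M₁ → M₁) (u₁ : Fin n → M₁)
    (ι₂ : K →+* M₂) (δ₂ : M₂ → M₂) (u₂ : Fin n → M₂)
    (h₁ : IsPicardVessiot δK ι₁ δ₁ a u₁)
    (h₂ : IsPicardVessiot δK ι₂ δ₂ a u₂) :
    ∃ e : M₁ ≃+* M₂, (∀ c : K, e (ι₁ c) = ι₂ c) ∧ ∀ x : M₁, e (δ₁ x) = δ₂ (e x) := by
  classical
  let dK : K →+ K := AddMonoidHom.mk' δK hadd
  let d₁ : M₁ →+ M₁ := AddMonoidHom.mk' δ₁ h₁.der_add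
  let d₂ : M₂ →+ M₂ := AddMonoidHom.mk' δ₂ h₂.der_add
  let C : Subfield K :=
    { carrier := {c | δK c = 0}
      mul_mem' := fun {x y} hx hy => by
        change δK (x * y) = 0
        rw [hmul, show δK x = 0 from hx, show δK y = 0 from hy, mul_zero, mul_zero, add_zero]
      one_mem' := by
        change δK 1 = 0
        simpa using hmul 1 1
      add_mem' := fun {x y} hx hy => by
        change δK (x + y) = 0
        rw [hadd, show δK x = 0 from hx, show δK y = 0 from hy, add_zero]
      zero_mem' := dK.map_zero
      neg_mem' := fun {x} hx => by
        change dK (-x) = 0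
        rw [map_neg, show dK x = 0 from hx, neg_zero]
      inv_mem' := fun x hx => by
        change dK x⁻¹ = 0
        rw [pv_derInv dK hmul, show dK x = 0 from hx, mul_zero, neg_zero] }
  have hCmem : ∀ c : C, δK c = 0 := fun c => c.2
  have hCac : IsAlgClosed C := by
    refine IsAlgClosed.of_exists_root _ fun p _ hp => ?_
    obtain ⟨c, hc, hc0⟩ := halgclosed (p.map C.subtype)
      (fun i => by rw [Polynomial.coeff_map]; exact hCmem _)
      (by rw [Polynomial.degree_map]; exact Polynomial.degree_pos_of_irreducible hp)
    refine ⟨⟨c, hc⟩, C.subtype.injective ?_⟩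
    rw [map_zero, ← hc0, ← Polynomial.eval_map_apply]
    rfl
  let _ := ι₁.toAlgebra
  let _ := ι₂.toAlgebra
  let _ : Algebra C M₁ := (ι₁.comp C.subtype).toAlgebra
  let _ : Algebra C M₂ := (ι₂.comp C.subtype).toAlgebra
  have : @IsScalarTower C K M₁ Algebra.toSMul Algebra.toSMul Algebra.toSMul := IsScalarTower.of_algebraMap_eq fun _ => rfl
  have : @IsScalarTower C K M₂ Algebra.toSMul Algebra.toSMul Algebra.toSMul := IsScalarTower.of_algebraMap_eq fun _ => rfl
  have hC₁ : ∀ m, d₁ m = 0 ↔ m ∈ (algebraMap C M₁).range := by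
    intro m
    constructor
    · intro hm
      obtain ⟨c, hc, rfl⟩ := h₁.constants m hm
      exact ⟨⟨c, hc⟩, rfl⟩
    · rintro ⟨c, rfl⟩
      change δ₁ (ι₁ c) = 0
      rw [h₁.compat, hCmem, map_zero]
  have hC₂ : ∀ m, d₂ m = 0 ↔ m ∈ (algebraMap C M₂).range := by
    intro m
    constructor
    · intro hm
      obtain ⟨c, hc, rfl⟩ := h₂.constants m hm
      exact ⟨⟨c, hc⟩, rfl⟩
    · rintro ⟨c, rfl⟩
      change δ₂ (ι₂ c) = 0
      rw [h₂.compat, hCmem, map_zero]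
  let U₁ : Matrix (Fin n) (Fin n) M₁ := Matrix.of fun i j : Fin n => δ₁^[(i : ℕ)] (u₁ j)
  let U₂ : Matrix (Fin n) (Fin n) M₂ := Matrix.of fun i j : Fin n => δ₂^[(i : ℕ)] (u₂ j)
  let H : Matrix (Fin n) (Fin n) K := Matrix.of fun i k : Fin n =>
    if (i : ℕ) + 1 < n then (if (k : ℕ) = i + 1 then (1 : K) else 0) else - a k.rev
  have hU₁ : U₁.map d₁ = H.map (algebraMap K M₁) * U₁ := pv_companion ι₁ δ₁ a u₁ h₁.sol
  have hU₂ : U₂.map d₂ = H.map (algebraMap K M₂) * U₂ := pv_companion ι₂ δ₂ a u₂ h₂.sol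
  obtain ⟨A, A', hA, hAp⟩ := pv_lemB (C := C) δK d₂ d₁ h₂.der_mul h₁.der_mul h₂.compat h₁.compat hC₂
    H U₂ U₁ hU₂ hU₁ h₂.wronskian_ne_zero h₁.wronskian_ne_zero
  obtain ⟨B, B', hB, hBp⟩ := pv_lemB (C := C) δK d₁ d₂ h₁.der_mul h₂.der_mul h₁.compat h₂.compat hC₁
    H U₁ U₂ hU₁ hU₂ h₁.wronskian_ne_zero h₂.wronskian_ne_zero
  have hmm : ∀ X Y : Matrix (Fin n) (Fin n) C, X * Y = 1 →
      X.map C.subtype * Y.map C.subtype = 1 := by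
    intro X Y h
    rw [← Matrix.map_mul, h, Matrix.map_one _ (map_zero _) (map_one _)]
  have hiff := pv_lemC U₂ U₁ (A.map C.subtype) (A'.map C.subtype) (B.map C.subtype)
    (B'.map C.subtype) (hmm _ _ hA) (hmm _ _ hB) hAp hBp
  have hg₁ : Subfield.closure (Set.range (algebraMap K M₁) ∪
      Set.range (fun x : Fin n × Fin n => U₁ x.1 x.2)) = ⊤ := by
    rw [eq_top_iff, ← h₁.generates]
    refine Subfield.closure_mono (Set.union_subset_union_right _ ?_)
    rintro _ ⟨j, rfl⟩
    exact ⟨(⟨0, by have := j.2; omega⟩, j), rfl⟩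
  have hg₂ : Subfield.closure (Set.range (algebraMap K M₂) ∪
      Set.range (fun x : Fin n × Fin n => U₂ x.1 x.2)) = ⊤ := by
    rw [eq_top_iff, ← h₂.generates]
    refine Subfield.closure_mono (Set.union_subset_union_right _ ?_)
    rintro _ ⟨j, rfl⟩
    exact ⟨(⟨0, by have := j.2; omega⟩, j), rfl⟩
  have hg₂' := pv_gen U₂ _ _ (hmm _ _ hA) hg₂
  obtain ⟨e, he⟩ := pv_lemD _ _ hg₁ hg₂' hiff
  have heK : ∀ c : K, e (ι₁ c) = ι₂ c := by
    intro c
    have := he (MvPolynomial.C c)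
    rw [MvPolynomial.aeval_C, MvPolynomial.aeval_C] at this
    exact this
  set V : Matrix (Fin n) (Fin n) M₂ := U₂ * (A.map C.subtype).map (algebraMap K M₂) with hVdef
  have heU : ∀ i j, e (U₁ i j) = V i j := by
    intro i j
    have := he (MvPolynomial.X (i, j))
    rw [MvPolynomial.aeval_X, MvPolynomial.aeval_X] at this
    exact this
  have hV : ∀ i j, d₂ (V i j) = (H.map (algebraMap K M₂) * V) i j := by
    intro i j
    rw [hVdef, ← Matrix.mul_assoc, ← hU₂, Matrix.mul_apply, Matrix.mul_apply, map_sum]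
    refine Finset.sum_congr rfl fun k _ => ?_
    have h0 : d₂ ((A.map C.subtype).map (algebraMap K M₂) k j) = 0 := (hC₂ _).2 ⟨A k j, rfl⟩
    have := h₂.der_mul (U₂ i k) ((A.map C.subtype).map (algebraMap K M₂) k j)
    change d₂ _ = _ * d₂ _ + _ * d₂ _ at this
    rw [this, h0, mul_zero, zero_add, mul_comm]
    rfl
  refine ⟨e, heK, ?_⟩
  let S : Subfield M₁ :=
    { carrier := {z | e (d₁ z) = d₂ (e z)}
      mul_mem' := fun {x y} hx hy => by
        have hx' : e (d₁ x) = d₂ (e x) := hx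
        have hy' : e (d₁ y) = d₂ (e y) := hy
        have e1 : d₁ (x * y) = x * d₁ y + y * d₁ x := h₁.der_mul x y
        have e2 : d₂ (e x * e y) = e x * d₂ (e y) + e y * d₂ (e x) := h₂.der_mul _ _
        change e (d₁ (x * y)) = d₂ (e (x * y))
        rw [e1, map_mul e x y, e2, map_add, map_mul, map_mul, hx', hy']
      one_mem' := by
        have e1 : d₁ 1 = 0 := by
          change δ₁ 1 = 0
          simpa using h₁.der_mul 1 1
        have e2 : d₂ 1 = 0 := by
          change δ₂ 1 = 0
          simpa using h₂.der_mul 1 1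
        change e (d₁ 1) = d₂ (e 1)
        rw [map_one e, e1, e2, map_zero]
      add_mem' := fun {x y} hx hy => by
        change e (d₁ (x + y)) = d₂ (e (x + y))
        rw [map_add, map_add, map_add, map_add, show e (d₁ x) = _ from hx,
          show e (d₁ y) = _ from hy]
      zero_mem' := by
        change e (d₁ 0) = d₂ (e 0)
        simp
      neg_mem' := fun {x} hx => by
        change e (d₁ (-x)) = d₂ (e (-x))
        rw [map_neg, map_neg, map_neg, map_neg, show e (d₁ x) = _ from hx]
      inv_mem' := fun x hx => by
        change e (d₁ x⁻¹) = d₂ (e x⁻¹)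
        rw [map_inv₀ e, pv_derInv d₁ h₁.der_mul, pv_derInv d₂ h₂.der_mul, map_neg, map_mul, map_mul,
          map_inv₀ e, show e (d₁ x) = _ from hx] }
  have hS : S = ⊤ := by
    rw [eq_top_iff, ← hg₁, Subfield.closure_le]
    rintro _ (⟨c, rfl⟩ | ⟨⟨i, j⟩, rfl⟩)
    · change e (δ₁ (ι₁ c)) = δ₂ (e (ι₁ c))
      rw [h₁.compat, heK, heK, h₂.compat]
    · change e (d₁ (U₁ i j)) = d₂ (e (U₁ i j))
      have := congrFun (congrFun hU₁ i) j
      rw [Matrix.map_apply] at this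
      rw [heU, hV, this, Matrix.mul_apply, Matrix.mul_apply, map_sum]
      refine Finset.sum_congr rfl fun k _ => ?_
      rw [map_mul, heU]
      congr 1
      exact heK _
  intro x
  have hx : x ∈ S := by rw [hS]; trivial
  exact hx
end

section
/- Let K be a differential field of characteristic zero and let I ⊆ J be prime differential ideals of the differential polynomial ring K{x₁,…,xₙ} in n differential indeterminates. If the fraction fields of K{x₁,…,xₙ}/I and of K{x₁,…,xₙ}/J have finite and equal transcendence degree over K, then I = J. -/
theorem injective_of_surjective_of_trdeg_eq {K A B : Type*} [Field K] [CommRing A] [IsDomain A]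
    [CommRing B] [IsDomain B] [Algebra K A] [Algebra K B] (f : A →ₐ[K] B)
    (hf : Function.Surjective f) (d : ℕ)
    (hA : Algebra.trdeg K A = d) (hB : Algebra.trdeg K B = d) : Function.Injective f := by
  obtain ⟨s, hs⟩ := exists_isTranscendenceBasis K B
  have hcard : Cardinal.mk s = d := by rw [hs.cardinalMk_eq_trdeg, hB]
  let x : s → A := fun b => Function.surjInv hf b
  have hfx : f ∘ x = ((↑) : s → B) := by
    funext b; exact Function.surjInv_eq hf b
  have hx : AlgebraicIndependent K x :=
    AlgebraicIndependent.of_comp f (by rw [hfx]; exact hs.1)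
  have hxt : IsTranscendenceBasis K x :=
    hx.isTranscendenceBasis_of_lift_trdeg_le (by rw [hA]; exact Cardinal.natCast_lt_aleph0)
      (by rw [hA, hcard]; simp)
  have halg := hxt.isAlgebraic
  rw [injective_iff_map_eq_zero]
  intro a ha
  by_contra hne
  obtain ⟨⟨r, hr⟩, hr0, c, hc⟩ :=
    (halg.1 a).exists_nonzero_dvd (mem_nonZeroDivisors_of_ne_zero hne)
  change r = a * c at hc
  have hfr : f r = 0 := by rw [hc, map_mul, ha, zero_mul]
  have hr' := hr
  rw [Algebra.adjoin_range_eq_range_aeval] at hr'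
  obtain ⟨P, hP⟩ := hr'
  change MvPolynomial.aeval x P = r at hP
  have h0 : MvPolynomial.aeval ((↑) : s → B) P = 0 := by
    rw [← hfr, ← hP, ← hfx]
    exact (MvPolynomial.comp_aeval_apply x f P).symm
  have hP0 : P = 0 := hs.1 (by rw [h0, map_zero])
  apply hr0
  apply Subtype.ext
  change r = 0
  rw [← hP, hP0, map_zero]

theorem trdeg_eq_of_fractionRing {K A : Type*} [Field K] [CommRing A] [IsDomain A]
    [Algebra K A] (d : ℕ) (h : ∃ x : Fin d → FractionRing A, IsTranscendenceBasis K x) :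
    Algebra.trdeg K A = d := by
  obtain ⟨x, hx⟩ := h
  have halg : Algebra.IsAlgebraic A (FractionRing A) :=
    IsLocalization.isAlgebraic (FractionRing A) (nonZeroDivisors A)
  have h1 := hx.lift_cardinalMk_eq_trdeg
  have h2 := _root_.trdeg_add_eq K A (A := FractionRing A)
  rw [trdeg_eq_zero (R := A) (A := FractionRing A), add_zero] at h2
  rw [h2]
  simpa using h1.symm

/-- Let `K` be a differential field of characteristic zero and let
`I ⊆ J` be prime differential ideals of the differential polynomial ring
`K{x₁,…,xₙ}` (modelled as `MvPolynomial (Fin n × ℕ) K`, where the variable `(i, m)`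
stands for `x_i^(m)`, with derivation `D` extending the derivation `δ` of `K` and
sending `x_i^(m)` to `x_i^(m+1)`). If the fraction fields of `K{x₁,…,xₙ}/I` and of
`K{x₁,…,xₙ}/J` have finite and equal transcendence degree over `K` (witnessed by
finite transcendence bases of the same cardinality `d`), then `I = J`. -/
theorem prime_differential_ideals_eq_of_le_of_trdeg_eq
    {K : Type*} [Field K] [CharZero K]
    (δ : K → K)
    (hδadd : ∀ x y, δ (x + y) = δ x + δ y)
    (hδmul : ∀ x y, δ (x * y) = x * δ y + y * δ x)
    (n : ℕ)
    (D : MvPolynomial (Fin n × ℕ) K → MvPolynomial (Fin n × ℕ) K)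
    (hDadd : ∀ p q, D (p + q) = D p + D q)
    (hDmul : ∀ p q, D (p * q) = p * D q + q * D p)
    (hDC : ∀ a : K, D (MvPolynomial.C a) = MvPolynomial.C (δ a))
    (hDX : ∀ i : Fin n, ∀ m : ℕ, D (MvPolynomial.X (i, m)) = MvPolynomial.X (i, m + 1))
    (I J : Ideal (MvPolynomial (Fin n × ℕ) K))
    [I.IsPrime] [J.IsPrime]
    (hIdiff : ∀ Q ∈ I, D Q ∈ I) (hJdiff : ∀ Q ∈ J, D Q ∈ J)
    (hIJ : I ≤ J)
    (d : ℕ)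
    (hI : ∃ x : Fin d → FractionRing (MvPolynomial (Fin n × ℕ) K ⧸ I),
      IsTranscendenceBasis K x)
    (hJ : ∃ y : Fin d → FractionRing (MvPolynomial (Fin n × ℕ) K ⧸ J),
      IsTranscendenceBasis K y) :
    I = J := by
  refine le_antisymm hIJ fun q hq => ?_
  have hinj := injective_of_surjective_of_trdeg_eq (Ideal.Quotient.factorₐ K hIJ)
    (Ideal.Quotient.factor_surjective hIJ) d
    (trdeg_eq_of_fractionRing d hI) (trdeg_eq_of_fractionRing d hJ)
  rw [← Ideal.Quotient.eq_zero_iff_mem]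
  apply hinj
  rw [map_zero]
  exact Ideal.Quotient.eq_zero_iff_mem.mpr hq
end

section
/- Let K be a differential field of characteristic zero whose field of constants C is algebraically closed, and let M₁ and M₂ be Picard–Vessiot extensions of K contained in a common differential field extension of K. If the compositum M₁M₂ (the smallest subfield containing M₁ and M₂, which is a differential subfield) has the same field of constants as K, then M₁M₂ is a Picard–Vessiot extension of K for some linear homogeneous differential equation with coefficients in K. -/
/-- `M` (a subfield of a differential field extension `N` of `K`, with embedding
`ι : K →+* N` and derivation `δN`) is a Picard-Vessiot extension of `K` (inside `N`) for
some linear homogeneous differential equation with coefficients in `K`: `M` is generated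
over `K` by a fundamental system of solutions lying in `M`, and `M` has the same field of
constants as `K`. -/
def IsPicardVessiotSubfield {K N : Type*} [Field K] [Field N]
    (δK : K → K) (ι : K →+* N) (δN : N → N) (M : Subfield N) : Prop :=
  ∃ (n : ℕ) (a : Fin n → K) (u : Fin n → N),
    (∀ i, u i ∈ M) ∧
    (∀ i, δN^[n] (u i) + ∑ j : Fin n, ι (a j) * δN^[n - 1 - (j : ℕ)] (u i) = 0) ∧
    Matrix.det (Matrix.of fun i j : Fin n => δN^[(i : ℕ)] (u j)) ≠ 0 ∧
    M = Subfield.closure (Set.range ι ∪ Set.range u) ∧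
    (∀ z ∈ M, δN z = 0 → ∃ c : K, δK c = 0 ∧ ι c = z)


theorem pv_finite_values {C N : Type*} [Field C] [Field N] [Algebra C N]
    {Γ : Type*} [LinearOrderedCommGroupWithZero Γ] (v : Valuation N Γ)
    (hv : ∀ c : C, c ≠ 0 → v (algebraMap C N c) = 1) (s : Set N) (hs : s.Finite) :
    (v '' (Submodule.span C s : Set N)).Finite := by
  induction s, hs using Set.Finite.induction_on with
  | empty => simp
  | @insert a s _ _ ih =>
    have hsub : (v '' (Submodule.span C (insert a s) : Set N) \
        v '' (Submodule.span C s : Set N)).Subsingleton := by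
      have key : ∀ x ∈ v '' (Submodule.span C (insert a s) : Set N) \
          v '' (Submodule.span C s : Set N), ∃ y ∈ Submodule.span C s, v (a + y) = x := by
        rintro _ ⟨⟨z, hz, rfl⟩, hn⟩
        obtain ⟨c, y, hy, rfl⟩ := Submodule.mem_span_insert.1 hz
        by_cases hc : c = 0
        · exact absurd ⟨y, hy, by simp [hc]⟩ hn
        · refine ⟨c⁻¹ • y, Submodule.smul_mem _ _ hy, ?_⟩
          have : c • a + y = algebraMap C N c * (a + c⁻¹ • y) := by
            rw [← Algebra.smul_def, smul_add, smul_smul, mul_inv_cancel₀ hc, one_smul]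
          rw [this, map_mul, hv c hc, one_mul]
      intro x hx x' hx'
      by_contra hne
      obtain ⟨y, hy, rfl⟩ := key x hx
      obtain ⟨y', hy', rfl⟩ := key x' hx'
      have hd : v (y - y') = max (v (a + y)) (v (a + y')) := by
        have h2 := Valuation.map_add_of_distinct_val v (x := a + y) (y := -(a + y'))
          (by rwa [Valuation.map_neg])
        rw [Valuation.map_neg] at h2
        rw [← h2]
        congr 1; ring
      have hm : v (y - y') ∈ v '' (Submodule.span C s : Set N) :=
        ⟨_, Submodule.sub_mem _ hy hy', rfl⟩
      rw [hd] at hm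
      rcases max_choice (v (a + y)) (v (a + y')) with h | h
      · rw [h] at hm; exact hx.2 hm
      · rw [h] at hm; exact hx'.2 hm
    exact (hsub.finite.union ih).subset (fun x hx => by
      by_cases h : x ∈ v '' (Submodule.span C s : Set N)
      · exact Or.inr h
      · exact Or.inl ⟨hx, h⟩)

theorem pv_exists_val {C N : Type*} [Field C] [Field N] [Algebra C N] (t : N)
    (ht : Transcendental C t) :
    ∃ V : ValuationSubring N, (∀ c : C, c ≠ 0 → V.valuation (algebraMap C N c) = 1) ∧
      V.valuation t < 1 := by
  let A : Subring N := (Algebra.adjoin C {t}).toSubring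
  have htA : t ∈ A := Algebra.subset_adjoin (Set.mem_singleton t)
  let I : Ideal A := Ideal.span {⟨t, htA⟩}
  have hI : I ≠ ⊤ := by
    intro h
    rw [Ideal.span_singleton_eq_top, isUnit_iff_exists_inv] at h
    obtain ⟨⟨q, hq⟩, h⟩ := h
    have hq' : q ∈ Algebra.adjoin C {t} := hq
    rw [Algebra.adjoin_singleton_eq_range_aeval] at hq'
    obtain ⟨p, rfl⟩ := hq'
    have h1 : t * Polynomial.aeval t p = 1 := congrArg Subtype.val h
    apply ht
    refine ⟨Polynomial.X * p - 1, ?_, ?_⟩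
    · intro h0
      have := congrArg (Polynomial.eval 0) h0
      simp at this
    · simp only [map_sub, map_mul, Polynomial.aeval_X, map_one]
      exact sub_eq_zero.2 h1
  obtain ⟨V, hV1, hV2⟩ := I.image_subset_nonunits_valuationSubring hI
  have hle : ∀ c : C, V.valuation (algebraMap C N c) ≤ 1 := fun c =>
    (V.valuation_le_one_iff _).2 (hV1 ((Algebra.adjoin C {t}).algebraMap_mem c))
  refine ⟨V, fun c hc => le_antisymm (hle c) ?_, ?_⟩
  · have h := hle c⁻¹
    rw [map_inv₀, map_inv₀] at h
    have h0 : V.valuation (algebraMap C N c) ≠ 0 := by simpa using hc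
    exact (inv_le_one₀ (zero_lt_iff.2 h0)).1 h
  · exact V.mem_nonunits_iff.1 (hV2 ⟨_, Ideal.subset_span rfl, rfl⟩)

theorem pv_indep_pow {C N : Type*} [Field C] [Field N] [Algebra C N] (t : N)
    (ht : Transcendental C t) {n₁ n₂ : ℕ} (u : Fin n₁ → N) (v : Fin n₂ → N)
    (hu : LinearIndependent C u) (hv : LinearIndependent C v) :
    ∃ m : ℕ, LinearIndependent C (Sum.elim u (fun j => t ^ m * v j)) := by
  obtain ⟨V, hV, hVt⟩ := pv_exists_val t ht
  have ht0 : t ≠ 0 := by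
    rintro rfl
    exact ht isAlgebraic_zero
  by_contra! hcon
  have hF := Set.Finite.image2 (fun a b => a / b)
    (pv_finite_values V.valuation hV _ (Set.finite_range u))
    (pv_finite_values V.valuation hV _ (Set.finite_range v))
  have hinj : Function.Injective (fun m : ℕ => V.valuation t ^ m) :=
    (pow_right_strictAnti₀ (zero_lt_iff.2 (by simpa using ht0)) hVt).injective
  refine (Set.infinite_range_of_injective hinj) (hF.subset ?_)
  rintro _ ⟨m, rfl⟩
  have hm := hcon m
  have hlm : (fun j => t ^ m * v j) = LinearMap.mulLeft C (t ^ m) ∘ v := by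
    ext; simp
  have hi2 : LinearIndependent C (fun j => t ^ m * v j) := by
    rw [hlm]
    refine hv.map' _ (LinearMap.ker_eq_bot.2 ?_)
    exact mul_right_injective₀ (pow_ne_zero _ ht0)
  have hnd : ¬ Disjoint (Submodule.span C (Set.range u))
      (Submodule.span C (Set.range (fun j => t ^ m * v j))) := fun h =>
    hm (hu.sum_type hi2 h)
  rw [Submodule.disjoint_def] at hnd
  push Not at hnd
  obtain ⟨x, hx1, hx2, hx0⟩ := hnd
  rw [hlm, Set.range_comp, Submodule.span_image] at hx2
  obtain ⟨g, hg, rfl⟩ := hx2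
  refine ⟨_, ⟨_, hx1, rfl⟩, _, ⟨g, hg, rfl⟩, ?_⟩
  have hg0 : V.valuation g ≠ 0 := by
    rw [Valuation.ne_zero_iff]; rintro rfl; simp at hx0
  simp [hg0]

/-- The subfield of constants of a derivation. -/
def pvConst {N : Type*} [Field N] (D : Derivation ℤ N N) : Subfield N where
  carrier := {x | D x = 0}
  mul_mem' := by
    intro a b ha hb
    simp only [Set.mem_ofPred_eq] at *
    simp [ha, hb]
  one_mem' := by simp
  add_mem' := by
    intro a b ha hb
    simp only [Set.mem_ofPred_eq] at *
    simp [ha, hb]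
  zero_mem' := by simp
  neg_mem' := by
    intro a ha
    simp only [Set.mem_ofPred_eq] at *
    simp [ha]
  inv_mem' := by
    intro a ha
    simp only [Set.mem_ofPred_eq] at *
    simp [Derivation.leibniz_inv, ha]

theorem pv_mem_const {N : Type*} [Field N] (D : Derivation ℤ N N) (x : N) :
    x ∈ pvConst D ↔ D x = 0 := Iff.rfl

/-- The derivation, linear over the constants. -/
def pvDer {N : Type*} [Field N] (D : Derivation ℤ N N) : Derivation (pvConst D) N N :=
  Derivation.mk'
    { toFun := D
      map_add' := map_add D
      map_smul' := by
        rintro ⟨c, hc⟩ x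
        rw [pv_mem_const] at hc
        simp [Subfield.smul_def, hc] }
    (by intro a b; simp)

theorem pv_transcendental {N : Type*} [Field N] [CharZero N] (D : Derivation ℤ N N) (t : N)
    (ht : D t ≠ 0) : Transcendental (pvConst D) t := by
  intro halg
  have hinteg := halg.isIntegral
  have hsep := (minpoly.irreducible hinteg).separable
  have h1 := hsep.aeval_derivative_ne_zero (minpoly.aeval (pvConst D) t)
  have h2 := (pvDer D).map_aeval (minpoly (pvConst D) t) t
  rw [minpoly.aeval, map_zero, smul_eq_mul] at h2
  rcases mul_eq_zero.1 h2.symm with h | h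
  · exact h1 h
  · exact ht h

/-- Solutions of a linear system which are linearly independent over constants (via their first
coordinate functional) are linearly independent. -/
theorem pv_indep_of_const {N : Type*} [Field N] (D : Derivation ℤ N N) {R B : Type*} [Fintype R]
    (A : R → R → N) (F : B → R → N) (hF : ∀ b i, D (F b i) = ∑ k, A i k * F b k)
    (f : B → N) (hf : ∀ (s : Finset B) (c : B → N), (∀ i, ∑ b ∈ s, c b * F b i = 0) →
      ∑ b ∈ s, c b * f b = 0)
    (hli : LinearIndependent (pvConst D) f) : LinearIndependent N F := by
  classical
  rw [linearIndependent_iff']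
  intro s
  induction s using Finset.induction_on with
  | empty => simp
  | @insert b s hb ih =>
    intro g hg
    by_cases h0 : g b = 0
    · rw [Finset.sum_insert hb, h0, zero_smul, zero_add] at hg
      intro i hi
      rcases Finset.mem_insert.1 hi with rfl | hi
      · exact h0
      · exact ih g hg i hi
    · exfalso
      let c : B → N := fun i => g i / g b
      have hcb : c b = 1 := div_self h0
      have hc : ∀ i, ∑ x ∈ insert b s, c x * F x i = 0 := by
        intro i
        have := congrFun hg i
        simp only [Finset.sum_apply, Pi.smul_apply, smul_eq_mul, Pi.zero_apply] at this
        have h2 : ∑ x ∈ insert b s, c x * F x i = (∑ x ∈ insert b s, g x * F x i) / g b := by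
          rw [Finset.sum_div]
          exact Finset.sum_congr rfl (fun x _ => by simp only [c]; ring)
        rw [h2, this, zero_div]
      have hD : ∀ i, ∑ x ∈ insert b s, D (c x) * F x i = 0 := by
        intro i
        have h1 := congrArg D (hc i)
        rw [map_zero, map_sum] at h1
        simp only [Derivation.leibniz, smul_eq_mul, hF, Finset.sum_add_distrib] at h1
        have h2 : ∑ x ∈ insert b s, c x * ∑ k, A i k * F x k = 0 := by
          simp only [Finset.mul_sum]
          rw [Finset.sum_comm]
          apply Finset.sum_eq_zero
          intro k _
          have := hc k
          calc _ = A i k * ∑ x ∈ insert b s, c x * F x k := by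
                rw [Finset.mul_sum]; exact Finset.sum_congr rfl (fun x _ => by ring)
            _ = 0 := by rw [this, mul_zero]
        rw [h2, zero_add] at h1
        rw [← h1]
        exact Finset.sum_congr rfl (fun x _ => by ring)
      have hcs : ∀ x ∈ s, D (c x) = 0 := by
        apply ih
        ext i
        have := hD i
        rw [Finset.sum_insert hb, hcb, Derivation.map_one_eq_zero, zero_mul, zero_add] at this
        simpa using this
      have hcs' : ∀ x ∈ insert b s, D (c x) = 0 := by
        intro x hx
        rcases Finset.mem_insert.1 hx with rfl | hx
        · rw [hcb]; simp
        · exact hcs x hx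
      have hrel := hf _ c hc
      rw [linearIndependent_iff'] at hli
      let c' : B → pvConst D := fun x => if h : D (c x) = 0 then ⟨c x, h⟩ else 0
      have hz := hli (insert b s) c' (by
        rw [← hrel]
        refine Finset.sum_congr rfl (fun x hx => ?_)
        simp only [c', dif_pos (hcs' x hx)]
        rfl) b (Finset.mem_insert_self _ _)
      simp only [c', dif_pos (hcs' b (Finset.mem_insert_self _ _))] at hz
      have := congrArg Subtype.val hz
      simp only [hcb] at this
      exact one_ne_zero this

theorem pv_iter_smul {N : Type*} [Field N] (D : Derivation ℤ N N) (k : ℕ) {B : Type*}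
    (s : Finset B) (c : B → pvConst D) (f : B → N) :
    D^[k] (∑ b ∈ s, c b • f b) = ∑ b ∈ s, c b • D^[k] (f b) := by
  induction k with
  | zero => simp
  | succ k ih =>
    rw [Function.iterate_succ_apply', ih]
    have h : ∀ x, D x = pvDer D x := fun x => rfl
    rw [h, map_sum]
    refine Finset.sum_congr rfl (fun x _ => ?_)
    rw [Derivation.map_smul, ← h, Function.iterate_succ_apply']

/-- Nonzero Wronskian implies independence over constants. -/
theorem pv_indep_of_wronskian {N : Type*} [Field N] (D : Derivation ℤ N N) {n : ℕ} (u : Fin n → N)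
    (hW : Matrix.det (Matrix.of fun i j : Fin n => D^[(i : ℕ)] (u j)) ≠ 0) :
    LinearIndependent (pvConst D) u := by
  rw [Fintype.linearIndependent_iff]
  intro g hg
  have h0 : (Matrix.of fun i j : Fin n => D^[(i : ℕ)] (u j)).mulVec (fun j => (g j : N)) = 0 := by
    ext i
    have h1 := pv_iter_smul D i Finset.univ g u
    rw [hg] at h1
    have h2 : D^[(i : ℕ)] 0 = 0 := Function.iterate_fixed (map_zero D) _
    rw [h2] at h1
    simp only [Matrix.mulVec, dotProduct, Matrix.of_apply, Pi.zero_apply]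
    rw [h1]
    exact Finset.sum_congr rfl (fun x _ => by rw [Subfield.smul_def, smul_eq_mul, mul_comm])
  have := Matrix.eq_zero_of_mulVec_eq_zero hW h0
  intro i
  exact Subtype.ext (congrFun this i)

/-- `f` is a row vector `p Y` with `Y` a fundamental matrix of a linear system over `K`. -/
def PvSol {K N : Type*} [Field K] [Field N] (ι : K →+* N) (D : Derivation ℤ N N)
    {B : Type} [Fintype B] [DecidableEq B] (f : B → N) : Prop :=
  ∃ (A : Matrix B B K) (p : B → K) (Y Z : Matrix B B N), Y * Z = 1 ∧
    (∀ i j, D (Y i j) = ∑ k, ι (A i k) * Y k j) ∧ ∀ j, f j = ∑ i, ι (p i) * Y i j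

theorem PvSol.prod {K N : Type*} [Field K] [Field N] {ι : K →+* N} {D : Derivation ℤ N N}
    {B B' : Type} [Fintype B] [DecidableEq B] [Fintype B'] [DecidableEq B'] {f : B → N}
    {g : B' → N} (hf : PvSol ι D f) (hg : PvSol ι D g) :
    PvSol ι D (fun x : B × B' => f x.1 * g x.2) := by
  obtain ⟨A, p, Y, Z, hYZ, hY, hp⟩ := hf
  obtain ⟨A', p', Y', Z', hYZ', hY', hp'⟩ := hg
  refine ⟨Matrix.kronecker A 1 + Matrix.kronecker 1 A', fun x => p x.1 * p' x.2,
    Matrix.kronecker Y Y', Matrix.kronecker Z Z', ?_, ?_, ?_⟩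
  · unfold Matrix.kronecker
    rw [← Matrix.mul_kronecker_mul, hYZ, hYZ', Matrix.one_kronecker_one]
  · rintro ⟨i, i'⟩ ⟨j, j'⟩
    simp only [Matrix.kroneckerMap_apply, Matrix.kronecker, Derivation.leibniz, smul_eq_mul, hY,
      hY', Matrix.add_apply, map_add, map_mul, add_mul, Finset.sum_add_distrib,
      Fintype.sum_prod_type, Matrix.one_apply]
    rw [add_comm]
    congr 1
    · rw [Finset.mul_sum]
      refine Finset.sum_congr rfl (fun k _ => ?_)
      rw [Finset.sum_eq_single i']
      · simp; ring
      · intro b _ hb; simp [Ne.symm hb]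
      · simp
    · rw [Finset.sum_eq_single i]
      · rw [Finset.mul_sum]
        refine Finset.sum_congr rfl (fun k _ => ?_)
        simp; ring
      · intro b _ hb; simp [Ne.symm hb]
      · simp
  · rintro ⟨j, j'⟩
    simp only [hp, hp', Fintype.sum_prod_type, Finset.sum_mul_sum, Matrix.kroneckerMap_apply,
      Matrix.kronecker, map_mul]
    refine Finset.sum_congr rfl (fun k _ => Finset.sum_congr rfl (fun l _ => ?_))
    ring

theorem PvSol.sum {K N : Type*} [Field K] [Field N] {ι : K →+* N} {D : Derivation ℤ N N}
    {B B' : Type} [Fintype B] [DecidableEq B] [Fintype B'] [DecidableEq B'] {f : B → N}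
    {g : B' → N} (hf : PvSol ι D f) (hg : PvSol ι D g) :
    PvSol ι D (Sum.elim f g) := by
  obtain ⟨A, p, Y, Z, hYZ, hY, hp⟩ := hf
  obtain ⟨A', p', Y', Z', hYZ', hY', hp'⟩ := hg
  refine ⟨Matrix.fromBlocks A 0 0 A', Sum.elim p p', Matrix.fromBlocks Y 0 0 Y',
    Matrix.fromBlocks Z 0 0 Z', ?_, ?_, ?_⟩
  · simp [Matrix.fromBlocks_multiply, hYZ, hYZ']
  · rintro (i | i) (j | j) <;> simp [hY, hY']
  · rintro (j | j) <;> simp [hp, hp']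

theorem PvSol.of_equation {K N : Type*} [Field K] [Field N] {ι : K →+* N} {D : Derivation ℤ N N}
    {n : ℕ} (a : Fin n → K) (u : Fin n → N)
    (h : ∀ i, D^[n] (u i) + ∑ j : Fin n, ι (a j) * D^[n - 1 - (j : ℕ)] (u i) = 0)
    (hW : Matrix.det (Matrix.of fun i j : Fin n => D^[(i : ℕ)] (u j)) ≠ 0) :
    PvSol ι D u := by
  refine ⟨Matrix.of fun i j => if (i : ℕ) + 1 = n then - a j.rev else
    if (j : ℕ) = i + 1 then 1 else 0, fun i => if (i : ℕ) = 0 then 1 else 0,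
    Matrix.of fun i j : Fin n => D^[(i : ℕ)] (u j),
    (Matrix.of fun i j : Fin n => D^[(i : ℕ)] (u j))⁻¹,
    Matrix.mul_nonsing_inv _ (isUnit_iff_ne_zero.2 hW), ?_, ?_⟩
  · intro i j
    simp only [Matrix.of_apply]
    rw [← Function.iterate_succ_apply' (f := D)]
    by_cases hi : (i : ℕ) + 1 = n
    · simp only [hi, if_true]
      have := h j
      rw [Nat.succ_eq_add_one, hi, eq_neg_of_add_eq_zero_left this, ← Finset.sum_neg_distrib]
      refine Fintype.sum_equiv Fin.revPerm _ _ (fun k => ?_)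
      simp only [Fin.revPerm_apply, Fin.rev_rev, map_neg, neg_mul, Fin.val_rev]
      congr 3
      omega
    · simp only [if_neg hi]
      have hlt : (i : ℕ) + 1 < n := by omega
      rw [Finset.sum_eq_single ⟨i + 1, hlt⟩]
      · simp
      · intro b _ hb
        have : (b : ℕ) ≠ i + 1 := fun h => hb (Fin.ext h)
        simp [this]
      · simp
  · intro j
    have hn : 0 < n := lt_of_le_of_lt (Nat.zero_le _) j.2
    rw [Finset.sum_eq_single ⟨0, hn⟩]
    · simp
    · intro b _ hb
      have : (b : ℕ) ≠ 0 := fun h => hb (Fin.ext h)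
      simp [this]
    · simp

/-- Coefficient vectors of the derivatives. -/
def pvRow {K : Type*} [Field K] (δ : Derivation ℤ K K) {B : Type} [Fintype B]
    (A : Matrix B B K) (p : B → K) : ℕ → B → K
  | 0 => p
  | k + 1 => fun j => δ (pvRow δ A p k j) + ∑ i, pvRow δ A p k i * A i j

theorem pv_row {K N : Type*} [Field K] [Field N] (ι : K →+* N) (D : Derivation ℤ N N)
    (δ : Derivation ℤ K K) (hcompat : ∀ c, D (ι c) = ι (δ c))
    {B : Type} [Fintype B]
    (A : Matrix B B K) (p : B → K) (Y : Matrix B B N) (f : B → N)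
    (hY : ∀ i j, D (Y i j) = ∑ k, ι (A i k) * Y k j) (hp : ∀ j, f j = ∑ i, ι (p i) * Y i j)
    (k : ℕ) (j : B) : D^[k] (f j) = ∑ i, ι (pvRow δ A p k i) * Y i j := by
  induction k with
  | zero => exact hp j
  | succ k ih =>
    rw [Function.iterate_succ_apply', ih, map_sum]
    simp only [Derivation.leibniz, smul_eq_mul, hcompat, hY, pvRow, map_add, map_sum, map_mul,
      add_mul, Finset.sum_add_distrib]
    rw [add_comm]
    congr 1
    · exact Finset.sum_congr rfl (fun x _ => by ring)
    · simp only [Finset.mul_sum, Finset.sum_mul]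
      rw [Finset.sum_comm]
      exact Finset.sum_congr rfl (fun x _ => Finset.sum_congr rfl (fun y _ => by ring))

theorem pv_minimal {K : Type*} [Field K] {B : Type} [Fintype B] (q : ℕ → B → K) :
    ∃ (r : ℕ) (b : Fin r → K), LinearIndependent K (fun i : Fin r => q i) ∧
      q r = ∑ i : Fin r, b i • q i := by
  classical
  have hex : ∃ r : ℕ, ¬ LinearIndependent K (fun i : Fin (r + 1) => q i) := by
    refine ⟨Fintype.card B, fun h => ?_⟩
    have := h.fintype_card_le_finrank
    simp at this
  have hlast := Nat.find_spec hex
  have hli : LinearIndependent K (fun i : Fin (Nat.find hex) => q i) := by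
    rcases Nat.eq_zero_or_pos (Nat.find hex) with h | h
    · have : IsEmpty (Fin (Nat.find hex)) := by rw [h]; infer_instance
      exact linearIndependent_empty_type
    · have := Nat.find_min hex (m := Nat.find hex - 1) (by omega)
      rw [not_not] at this
      rwa [Nat.sub_add_cancel h] at this
  refine ⟨Nat.find hex, ?_⟩
  by_contra! hno
  apply hlast
  have hmem : q (Nat.find hex) ∉ Submodule.span K (Set.range fun i : Fin (Nat.find hex) => q i) := by
    intro hm
    obtain ⟨c, hc⟩ := (Submodule.mem_span_range_iff_exists_fun K).1 hm
    exact hno c hli hc.symm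
  have := linearIndependent_finSnoc.2 ⟨hli, hmem⟩
  have hfun : (fun i : Fin (Nat.find hex + 1) => q i) =
      Fin.snoc (α := fun _ => B → K) (fun i : Fin (Nat.find hex) => q i) (q (Nat.find hex)) := by
    funext i
    refine Fin.lastCases ?_ (fun i => ?_) i <;> simp
  rw [hfun]
  exact this

/-- Main extraction. -/
theorem PvSol.extract {K N : Type*} [Field K] [Field N] {ι : K →+* N} {D : Derivation ℤ N N}
    (δ : Derivation ℤ K K) (hcompat : ∀ c, D (ι c) = ι (δ c))
    {B : Type} [Fintype B] [DecidableEq B] {f : B → N} (hf : PvSol ι D f)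
    {E : Type} (e : E → B) (hli : LinearIndependent (pvConst D) (f ∘ e)) :
    ∃ (r : ℕ) (a : Fin r → K) (w : Fin r → B),
      (∀ x, ∃ i, w i = e x) ∧
      (∀ i, D^[r] (f i) + ∑ j : Fin r, ι (a j) * D^[r - 1 - (j : ℕ)] (f i) = 0) ∧
      Matrix.det (Matrix.of fun i j : Fin r => D^[(i : ℕ)] (f (w j))) ≠ 0 := by
  obtain ⟨A, p, Y, Z, hYZ, hY, hp⟩ := hf
  have hrow := pv_row ι D δ hcompat A p Y f hY hp
  obtain ⟨r, b, hind, hr⟩ := pv_minimal (pvRow δ A p)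
  have heq : ∀ i, D^[r] (f i) = ∑ k : Fin r, ι (b k) * D^[(k : ℕ)] (f i) := by
    intro i
    simp only [hrow, hr, Finset.sum_apply, Pi.smul_apply, smul_eq_mul, map_sum, map_mul,
      Finset.mul_sum, Finset.sum_mul]
    rw [Finset.sum_comm]
    exact Finset.sum_congr rfl (fun x _ => Finset.sum_congr rfl (fun y _ => by ring))
  let F : B → Fin r → N := fun x k => D^[(k : ℕ)] (f x)
  -- derivative of F
  have hFd : ∀ x i, D (F x i) = ∑ k : Fin r, (if (i : ℕ) + 1 = r then ι (b k) else
      if (k : ℕ) = i + 1 then 1 else 0) * F x k := by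
    intro x i
    simp only [F]
    rw [← Function.iterate_succ_apply' (f := D), Nat.succ_eq_add_one]
    by_cases hi : (i : ℕ) + 1 = r
    · simp only [hi, if_true, heq]
    · simp only [if_neg hi]
      have hlt : (i : ℕ) + 1 < r := by omega
      rw [Finset.sum_eq_single ⟨i + 1, hlt⟩]
      · simp
      · intro b _ hb
        have : (b : ℕ) ≠ i + 1 := fun h => hb (Fin.ext h)
        simp [this]
      · simp
  have hFe : LinearIndependent N (F ∘ e) := by
    refine pv_indep_of_const D _ (F ∘ e) (fun x i => hFd (e x) i) (f ∘ e) ?_ hli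
    intro s c hc
    by_cases h0 : 0 < r
    · exact hc ⟨0, h0⟩
    · have hr0 : r = 0 := by omega
      subst hr0
      have : ∀ x, f x = 0 := fun x => by simpa using heq x
      simp [this]
  -- spanning
  have hspan : Submodule.span N (Set.range F) = ⊤ := by
    let P : Matrix (Fin r) B K := Matrix.of fun i j => pvRow δ A p i j
    have hP : ∃ Q : Matrix B (Fin r) K, P * Q = 1 := by
      rw [← Matrix.mulVec_surjective_iff_exists_right_inverse]
      have hrk : P.rank = r := by
        have : LinearIndependent K P.row := hind
        simpa using this.rank_matrix
      have : LinearMap.range P.mulVecLin = ⊤ := by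
        apply Submodule.eq_top_of_finrank_eq
        rw [← Matrix.rank, hrk]; simp
      exact LinearMap.range_eq_top.1 this
    obtain ⟨Q, hQ⟩ := hP
    rw [eq_top_iff]
    intro z _
    have hPQ : P.map ι * Q.map ι = 1 := by
      rw [← Matrix.map_mul, hQ, Matrix.map_one _ (map_zero _) (map_one _)]
    let c : B → N := (Z * Q.map ι).mulVec z
    have hz : z = (P.map ι * Y).mulVec c := by
      simp only [c]
      rw [Matrix.mulVec_mulVec, Matrix.mul_assoc, ← Matrix.mul_assoc Y, hYZ, Matrix.one_mul, hPQ,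
        Matrix.one_mulVec]
    have hz2 : z = ∑ x, c x • F x := by
      rw [hz]
      ext k
      simp only [Matrix.mulVec, dotProduct, Finset.sum_apply, Pi.smul_apply, smul_eq_mul, F, hrow,
        Matrix.mul_apply, Matrix.map_apply, P, Matrix.of_apply]
      exact Finset.sum_congr rfl (fun x _ => mul_comm _ _)
    rw [hz2]
    exact Submodule.sum_mem _ (fun x _ => Submodule.smul_mem _ _ (Submodule.subset_span ⟨x, rfl⟩))
  have hon : LinearIndepOn N F (Set.range e) :=
    (linearIndepOn_range_iff hFe.injective.of_comp F).2 hFe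
  let T := hon.extend (Set.subset_univ _)
  have hT : LinearIndepOn N F T := hon.linearIndepOn_extend _
  have hTs : Submodule.span N (F '' T) = ⊤ := by
    rw [hon.span_image_extend_eq_span_image, Set.image_univ, hspan]
  have hTe : Set.range e ⊆ T := hon.subset_extend _
  have hsp' : ⊤ ≤ Submodule.span N (Set.range fun x : T => F x) := by
    rw [← hTs, Set.image_eq_range]
  let bas : Module.Basis T N (Fin r → N) := Module.Basis.mk hT hsp'
  have hfin : Fintype T := Fintype.ofFinite T
  have hcard : Fintype.card T = r := by
    rw [← Module.finrank_eq_card_basis bas]; simp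
  let eq : Fin r ≃ T := (Fintype.equivFinOfCardEq hcard).symm
  refine ⟨r, fun j => - b j.rev, fun i => (eq i : B), ?_, ?_, ?_⟩
  · intro x
    exact ⟨eq.symm ⟨e x, hTe ⟨x, rfl⟩⟩, by simp⟩
  · intro i
    rw [heq, add_eq_zero_iff_eq_neg, ← Finset.sum_neg_distrib]
    refine Fintype.sum_equiv Fin.revPerm _ _ (fun k => ?_)
    simp only [Fin.revPerm_apply, Fin.rev_rev, map_neg, neg_mul, Fin.val_rev, neg_neg]
    congr 2
    omega
  · have hl : LinearIndependent N (fun i : Fin r => F (eq i)) :=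
      LinearIndependent.comp hT eq eq.injective
    rw [← isUnit_iff_ne_zero, ← Matrix.isUnit_iff_isUnit_det,
      ← Matrix.linearIndependent_cols_iff_isUnit]
    exact hl

theorem PvSol.pow {K N : Type*} [Field K] [Field N] {ι : K →+* N} {D : Derivation ℤ N N}
    {n₁ n₂ : ℕ} {u : Fin n₁ → N} {v : Fin n₂ → N} (hu : PvSol ι D u) (hv : PvSol ι D v)
    (M : Subfield N) (huM : ∀ i, u i ∈ M) (hvM : ∀ i, v i ∈ M) (i₀ : Fin n₁) (m : ℕ) :
    ∃ (B : Type) (_ : Fintype B) (_ : DecidableEq B) (f : B → N) (e : Fin n₂ → B),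
      PvSol ι D f ∧ (∀ x, f x ∈ M) ∧ ∀ j, f (e j) = u i₀ ^ m * v j := by
  induction m with
  | zero => exact ⟨Fin n₂, inferInstance, inferInstance, v, id, hv, hvM, by simp⟩
  | succ m ih =>
    obtain ⟨B, _, _, f, e, hf, hfM, he⟩ := ih
    refine ⟨Fin n₁ × B, inferInstance, inferInstance, _, fun j => (i₀, e j), hu.prod hf,
      fun x => M.mul_mem (huM _) (hfM _), fun j => ?_⟩
    simp only [he]
    ring

/-- Let `K` be a differential field of characteristic zero whose field of
constants is algebraically closed, and let `M₁`, `M₂` be Picard-Vessiot extensions of `K`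
contained in a common differential field extension `N` of `K`. If the compositum
`M₁ ⊔ M₂` has the same field of constants as `K`, then `M₁ ⊔ M₂` is a Picard-Vessiot
extension of `K` for some linear homogeneous differential equation with coefficients
in `K`. -/
theorem compositum_of_picardVessiot_isPicardVessiot
    {K N : Type*} [Field K] [CharZero K] [Field N]
    (δK : K → K)
    (hKadd : ∀ x y, δK (x + y) = δK x + δK y)
    (hKmul : ∀ x y, δK (x * y) = x * δK y + y * δK x)
    (halgclosed : ∀ p : Polynomial K, (∀ i, δK (p.coeff i) = 0) → 0 < p.degree →
      ∃ c : K, δK c = 0 ∧ Polynomial.eval c p = 0)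
    (ι : K →+* N) (δN : N → N)
    (hNadd : ∀ x y, δN (x + y) = δN x + δN y)
    (hNmul : ∀ x y, δN (x * y) = x * δN y + y * δN x)
    (hcompat : ∀ c : K, δN (ι c) = ι (δK c))
    (M₁ M₂ : Subfield N)
    (h₁ : IsPicardVessiotSubfield δK ι δN M₁)
    (h₂ : IsPicardVessiotSubfield δK ι δN M₂)
    (hconst : ∀ z ∈ M₁ ⊔ M₂, δN z = 0 → ∃ c : K, δK c = 0 ∧ ι c = z) :
    IsPicardVessiotSubfield δK ι δN (M₁ ⊔ M₂) := by
  have hcz : CharZero N := charZero_of_injective_ringHom ι.injective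
  let D : Derivation ℤ N N := Derivation.mk' (AddMonoidHom.mk' δN hNadd).toIntLinearMap
    (fun a b => hNmul a b)
  let δ : Derivation ℤ K K := Derivation.mk' (AddMonoidHom.mk' δK hKadd).toIntLinearMap
    (fun a b => hKmul a b)
  have hc : ∀ c, D (ι c) = ι (δ c) := hcompat
  have h₂' := h₂
  obtain ⟨n₁, a₁, u, huM, hu, hWu, hM₁, -⟩ := h₁
  obtain ⟨n₂, a₂, v, hvM, hv, hWv, hM₂, -⟩ := h₂
  by_cases hall : ∀ i, δN (u i) = 0
  · have hle : M₁ ≤ M₂ := by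
      rw [hM₁, Subfield.closure_le]
      have hι : Set.range ι ⊆ M₂ := by
        rw [hM₂]
        exact fun x hx => Subfield.subset_closure (Or.inl hx)
      rintro x (hx | ⟨i, rfl⟩)
      · exact hι hx
      · obtain ⟨c, -, hc⟩ := hconst (u i) ((le_sup_left : M₁ ≤ M₁ ⊔ M₂) (huM i)) (hall i)
        exact hι ⟨c, hc⟩
    rw [sup_eq_right.2 hle]
    exact h₂'
  · push Not at hall
    obtain ⟨i₀, hi₀⟩ := hall
    have su : PvSol ι D u := PvSol.of_equation a₁ u hu hWu
    have sv : PvSol ι D v := PvSol.of_equation a₂ v hv hWv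
    have huM' : ∀ i, u i ∈ M₁ ⊔ M₂ := fun i => (le_sup_left : M₁ ≤ M₁ ⊔ M₂) (huM i)
    have hvM' : ∀ i, v i ∈ M₁ ⊔ M₂ := fun i => (le_sup_right : M₂ ≤ M₁ ⊔ M₂) (hvM i)
    obtain ⟨m, hm⟩ := pv_indep_pow (u i₀) (pv_transcendental D (u i₀) hi₀) u v
      (pv_indep_of_wronskian D u hWu) (pv_indep_of_wronskian D v hWv)
    obtain ⟨B, _, _, f, e, hf, hfM, he⟩ := su.pow sv (M₁ ⊔ M₂) huM' hvM' i₀ m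
    have hcomp : Sum.elim u f ∘ Sum.map id e = Sum.elim u (fun j => u i₀ ^ m * v j) := by
      ext (x | x) <;> simp [he]
    obtain ⟨r, a, w, hw, heqn, hW⟩ := (su.sum hf).extract δ hc (Sum.map id e)
      (by rw [hcomp]; exact hm)
    have hwM : ∀ x, Sum.elim u f x ∈ M₁ ⊔ M₂ := by
      rintro (x | x)
      · exact huM' x
      · exact hfM x
    refine ⟨r, a, fun i => Sum.elim u f (w i), fun i => hwM _, fun i => heqn (w i), hW, ?_, hconst⟩
    apply le_antisymm
    · have hι : ∀ c, ι c ∈ Subfield.closure (Set.range ι ∪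
          Set.range fun i => Sum.elim u f (w i)) :=
        fun c => Subfield.subset_closure (Or.inl ⟨c, rfl⟩)
      have hin : ∀ x, Sum.elim u f (Sum.map id e x) ∈ Subfield.closure (Set.range ι ∪
          Set.range fun i => Sum.elim u f (w i)) := by
        intro x
        obtain ⟨i, hi⟩ := hw x
        exact Subfield.subset_closure (Or.inr ⟨i, by simp only [hi]⟩)
      have hui : ∀ i, u i ∈ Subfield.closure (Set.range ι ∪
          Set.range fun i => Sum.elim u f (w i)) := fun i => hin (Sum.inl i)
      have hne : u i₀ ≠ 0 := by
        intro h0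
        apply hi₀
        rw [h0]
        exact map_zero D
      refine sup_le ?_ ?_
      · rw [hM₁, Subfield.closure_le]
        rintro x (⟨c, rfl⟩ | ⟨i, rfl⟩)
        · exact hι c
        · exact hui i
      · rw [hM₂, Subfield.closure_le]
        rintro x (⟨c, rfl⟩ | ⟨j, rfl⟩)
        · exact hι c
        · have h1 := hin (Sum.inr j)
          simp only [Sum.map_inr, Sum.elim_inr, he] at h1
          have h2 := Subfield.mul_mem _ (Subfield.inv_mem _ (pow_mem (hui i₀) m)) h1
          rwa [inv_mul_cancel_left₀ (pow_ne_zero m hne)] at h2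
    · rw [Subfield.closure_le]
      rintro x (⟨c, rfl⟩ | ⟨i, rfl⟩)
      · refine (le_sup_left : M₁ ≤ M₁ ⊔ M₂) ?_
        rw [hM₁]
        exact Subfield.subset_closure (Or.inl ⟨c, rfl⟩)
      · exact hwM _
end

section
/- Let K be a differential field of characteristic zero whose field of constants C is algebraically closed, and let M be a Picard–Vessiot extension of K. Then M/K is normal in the differential sense: for every element z ∈ M with z ∉ K there exists a differential K-automorphism σ of M with σ(z) ≠ z. -/
universe v

namespace PVNormal

section One
open IntermediateField TensorProduct

theorem exists_adjoin_hom {K M : Type*} [Field K] [Field M] [Algebra K M] [CharZero K]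
    (z : M) (hz : z ∉ Set.range (algebraMap K M)) :
    ∃ τ : K⟮z⟯ →ₐ[K] AlgebraicClosure M,
      τ (AdjoinSimple.gen K z) ≠ algebraMap M (AlgebraicClosure M) z := by
  by_cases hint : IsIntegral K z
  · by_contra! hcon
    have hall : ∀ x ∈ (minpoly K z).aroots (AlgebraicClosure M),
        x = algebraMap M (AlgebraicClosure M) z := by
      intro x hx
      rw [← hcon ((algHomAdjoinIntegralEquiv K hint).symm ⟨x, hx⟩),
        algHomAdjoinIntegralEquiv_symm_apply_gen]
    have hsep : (minpoly K z).Separable := (minpoly.irreducible hint).separable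
    have hnd : ((minpoly K z).aroots (AlgebraicClosure M)).Nodup :=
      Polynomial.nodup_roots hsep.map
    have hcard : ((minpoly K z).aroots (AlgebraicClosure M)).card = (minpoly K z).natDegree := by
      rw [Polynomial.aroots, IsAlgClosed.card_roots_eq_natDegree, Polynomial.natDegree_map]
    have hle : ((minpoly K z).aroots (AlgebraicClosure M)).card ≤ 1 := by
      classical
      rw [← Multiset.toFinset_card_of_nodup hnd, Finset.card_le_one]
      intro a ha b hb
      rw [hall a (Multiset.mem_toFinset.1 ha), hall b (Multiset.mem_toFinset.1 hb)]
    have hpos := minpoly.natDegree_pos hint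
    have : (minpoly K z).natDegree = 1 := by omega
    exact hz (minpoly.natDegree_eq_one_iff.1 this)
  · have htr : Transcendental K z := fun h => hint h.isIntegral
    set w : AlgebraicClosure M := algebraMap M (AlgebraicClosure M) z with hw
    have htr1 : Transcendental K (w + 1) := by
      intro h
      have h1 : IsAlgebraic K w := by
        have := h.sub (isAlgebraic_one (R := K))
        simpa using this
      exact htr ((isAlgebraic_algebraMap_iff (algebraMap M (AlgebraicClosure M)).injective).1 h1)
    let e1 := RatFunc.algEquivOfTranscendental z htr
    let e2 := RatFunc.algEquivOfTranscendental (w + 1) htr1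
    refine ⟨(K⟮w + 1⟯.val.comp e2.toAlgHom).comp e1.symm.toAlgHom, ?_⟩
    have h1 : e1.symm (AdjoinSimple.gen K z) = RatFunc.X := by
      rw [AlgEquiv.symm_apply_eq]
      ext
      simp [e1]
    have h2 : ((e2 RatFunc.X : K⟮w + 1⟯) : AlgebraicClosure M) = w + 1 := by
      simp [e2]
    simp [h1, h2]

theorem exists_compositum {F : Type*} {M L : Type v} [Field F] [Field M] [Field L] [Algebra F M]
    [Algebra F L] :
    ∃ (Ω : Type v) (_ : Field Ω) (f : M →+* Ω) (g : L →+* Ω),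
      ∀ x : F, f (algebraMap F M x) = g (algebraMap F L x) := by
  obtain ⟨m, hm⟩ := Ideal.exists_maximal (M ⊗[F] L)
  refine ⟨(M ⊗[F] L) ⧸ m, Ideal.Quotient.field m, (Ideal.Quotient.mk m).comp
    (Algebra.TensorProduct.includeLeft (R := F) (S := F) (A := M) (B := L)).toRingHom,
    (Ideal.Quotient.mk m).comp
    (Algebra.TensorProduct.includeRight (R := F) (A := M) (B := L)).toRingHom, ?_⟩
  intro x
  change Ideal.Quotient.mk m ((algebraMap F M x) ⊗ₜ 1) =
    Ideal.Quotient.mk m (1 ⊗ₜ (algebraMap F L x))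
  rw [Algebra.algebraMap_eq_smul_one, Algebra.algebraMap_eq_smul_one, TensorProduct.smul_tmul]

theorem exists_two_embeddings {K : Type*} {M : Type v} [Field K] [Field M] [Algebra K M]
    [CharZero K] (z : M) (hz : z ∉ Set.range (algebraMap K M)) :
    ∃ (Ω : Type v) (_ : Field Ω) (f g : M →+* Ω),
      (∀ c : K, f (algebraMap K M c) = g (algebraMap K M c)) ∧ f z ≠ g z := by
  obtain ⟨τ, hτ⟩ := exists_adjoin_hom z hz
  obtain ⟨Ω, hΩ, f, g', key⟩ := @exists_compositum K⟮z⟯ M (AlgebraicClosure M) _ _ _ _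
    τ.toRingHom.toAlgebra
  have key : ∀ x : K⟮z⟯, f (x : M) = g' (τ x) := key
  refine ⟨Ω, hΩ, f, g'.comp (algebraMap M (AlgebraicClosure M)), ?_, ?_⟩
  · intro c
    have := key (algebraMap K K⟮z⟯ c)
    rw [AlgHom.commutes] at this
    exact this
  · have := key (AdjoinSimple.gen K z)
    rw [AdjoinSimple.coe_gen] at this
    rw [this]
    intro h
    exact hτ (g'.injective h)

end One

section Two
open MvPolynomial

/-- Apply an additive map to all coefficients. -/
noncomputable def mapCoeff (s : Type*) {A B : Type*} [CommRing A] [CommRing B] (f : A →+ B) :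
    MvPolynomial s A →+ MvPolynomial s B where
  toFun p := ∑ m ∈ p.support, monomial m (f (coeff m p))
  map_zero' := by simp
  map_add' p q := by
    classical
    have key : ∀ (p : MvPolynomial s A) (m : s →₀ ℕ),
        coeff m (∑ m ∈ p.support, monomial m (f (coeff m p))) = f (coeff m p) := by
      intro p m
      simp only [coeff_sum, coeff_monomial]
      rw [Finset.sum_ite_eq']
      split_ifs with h
      · rfl
      · rw [notMem_support_iff.1 h, map_zero]
    ext m
    rw [coeff_add, key, key, key, coeff_add, map_add]

@[simp] theorem coeff_mapCoeff {s A B : Type*} [CommRing A] [CommRing B] (f : A →+ B)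
    (p : MvPolynomial s A) (m : s →₀ ℕ) : coeff m (mapCoeff s f p) = f (coeff m p) := by
  classical
  change coeff m (∑ m ∈ p.support, monomial m (f (coeff m p))) = _
  simp only [coeff_sum, coeff_monomial]
  rw [Finset.sum_ite_eq']
  split_ifs with h
  · rfl
  · rw [notMem_support_iff.1 h, map_zero]

theorem mapCoeff_monomial {s A B : Type*} [CommRing A] [CommRing B] (f : A →+ B)
    (m : s →₀ ℕ) (a : A) : mapCoeff s f (monomial m a) = monomial m (f a) := by
  classical
  ext k
  rw [coeff_mapCoeff, coeff_monomial, coeff_monomial]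
  split_ifs <;> simp

theorem mapCoeff_mul {s A : Type*} [CommRing A] (d : A →+ A)
    (hd : ∀ x y, d (x * y) = x * d y + y * d x) (p q : MvPolynomial s A) :
    mapCoeff s d (p * q) = p * mapCoeff s d q + q * mapCoeff s d p := by
  induction p using MvPolynomial.induction_on' with
  | add p1 p2 h1 h2 => rw [add_mul, map_add, h1, h2, map_add]; ring
  | monomial m a =>
    induction q using MvPolynomial.induction_on' with
    | add p1 p2 h1 h2 => rw [mul_add, map_add, h1, h2, map_add]; ring
    | monomial k b =>
      simp only [monomial_mul, mapCoeff_monomial, hd, map_add]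
      rw [add_comm k m]

/-- Differentially stable ideals are generated by their constants. -/
theorem mem_span_constants {s C M : Type*} [Field C] [Field M] [Algebra C M] (d : M →+ M)
    (hd1 : d 1 = 0)
    (hconst : ∀ x, d x = 0 → ∃ c : C, algebraMap C M c = x)
    (J : Ideal (MvPolynomial s M)) (hJ : ∀ f ∈ J, mapCoeff s d f ∈ J) :
    ∀ f ∈ J, f ∈ Submodule.span M
      {g | g ∈ J ∧ ∃ g0 : MvPolynomial s C, MvPolynomial.map (algebraMap C M) g0 = g} := by
  classical
  suffices H : ∀ (N : ℕ) (f : MvPolynomial s M), f ∈ J → f.support.card ≤ N →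
      f ∈ Submodule.span M
      {g | g ∈ J ∧ ∃ g0 : MvPolynomial s C, MvPolynomial.map (algebraMap C M) g0 = g} from
    fun f hf => H _ f hf le_rfl
  have hsm : ∀ (a : M) (f : MvPolynomial s M), f ∈ J → a • f ∈ J := by
    intro a f hf
    rw [smul_eq_C_mul]
    exact J.mul_mem_left _ hf
  intro N
  induction N with
  | zero =>
    intro f _ h0
    have : f = 0 := by simpa using h0
    rw [this]; exact Submodule.zero_mem _
  | succ N ih =>
    intro f hf hN
    by_cases hf0 : f = 0
    · rw [hf0]; exact Submodule.zero_mem _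
    by_cases hmin : ∃ h ∈ J, h ≠ 0 ∧ h.support ⊂ f.support
    · obtain ⟨h, hhJ, hh0, hss⟩ := hmin
      have hhS := ih h hhJ (by have := Finset.card_lt_card hss; omega)
      obtain ⟨m, hm⟩ := support_nonempty.2 hh0
      have hmc : coeff m h ≠ 0 := mem_support_iff.1 hm
      set a := coeff m f / coeff m h
      have hg : f - a • h ∈ J := J.sub_mem hf (hsm _ _ hhJ)
      have hsub : (f - a • h).support ⊂ f.support := by
        rw [Finset.ssubset_iff_of_subset]
        · refine ⟨m, hss.1 hm, ?_⟩
          rw [notMem_support_iff, coeff_sub, coeff_smul, smul_eq_mul, div_mul_cancel₀ _ hmc,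
            sub_self]
        · intro k hk
          by_contra hkf
          have hkh : k ∉ h.support := fun hk' => hkf (hss.1 hk')
          rw [mem_support_iff, coeff_sub, coeff_smul, notMem_support_iff.1 hkf,
            notMem_support_iff.1 hkh] at hk
          simp at hk
      have := ih _ hg (by have := Finset.card_lt_card hsub; omega)
      have h2 := Submodule.add_mem _ this (Submodule.smul_mem _ a hhS)
      simpa using h2
    · push Not at hmin
      obtain ⟨m, hm⟩ := support_nonempty.2 hf0
      have hmc : coeff m f ≠ 0 := mem_support_iff.1 hm
      set g := (coeff m f)⁻¹ • f with hg
      have hgJ : g ∈ J := hsm _ _ hf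
      have hgm : coeff m g = 1 := by simp [hg, hmc]
      have hdg : mapCoeff s d g = 0 := by
        by_contra hne
        refine hmin _ (hJ g hgJ) hne ?_
        rw [Finset.ssubset_iff_of_subset]
        · refine ⟨m, hm, ?_⟩
          rw [notMem_support_iff, coeff_mapCoeff, hgm, hd1]
        · intro k hk
          by_contra hkf
          rw [mem_support_iff, coeff_mapCoeff, hg, coeff_smul, notMem_support_iff.1 hkf] at hk
          simp at hk
      have hgC : ∃ g0 : MvPolynomial s C, MvPolynomial.map (algebraMap C M) g0 = g := by
        change g ∈ Set.range _
        rw [MvPolynomial.mem_range_map_iff_coeffs_subset]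
        intro x hx
        obtain ⟨k, _, rfl⟩ := mem_coeffs_iff.1 (Finset.mem_coe.1 hx)
        apply hconst
        rw [← coeff_mapCoeff, hdg, coeff_zero]
      have : f = coeff m f • g := by rw [hg, smul_smul, mul_inv_cancel₀ hmc, one_smul]
      rw [this]
      exact Submodule.smul_mem _ _ (Submodule.subset_span ⟨hgJ, hgC⟩)

/-- Coordinates of elements of a differentially stable ideal. -/
theorem mapCoeff_mem {s C M : Type*} [Field C] [Field M] [Algebra C M] (d : M →+ M)
    (hd1 : d 1 = 0)
    (hconst : ∀ x, d x = 0 → ∃ c : C, algebraMap C M c = x)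
    (J : Ideal (MvPolynomial s M)) (hJ : ∀ f ∈ J, mapCoeff s d f ∈ J) (l : M →ₗ[C] C)
    (f : MvPolynomial s M) (hf : f ∈ J) :
    MvPolynomial.map (algebraMap C M) (mapCoeff s l.toAddMonoidHom f) ∈ J := by
  have := mem_span_constants d hd1 hconst J hJ f hf
  clear hf
  induction this using Submodule.span_induction generalizing l with
  | zero => simp
  | add x y _ _ hx hy => rw [map_add, map_add]; exact J.add_mem (hx l) (hy l)
  | mem g hg =>
    obtain ⟨hg, g0, rfl⟩ := hg
    have : MvPolynomial.map (algebraMap C M) (mapCoeff s l.toAddMonoidHom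
        (MvPolynomial.map (algebraMap C M) g0)) =
        MvPolynomial.C (algebraMap C M (l 1)) * MvPolynomial.map (algebraMap C M) g0 := by
      ext k
      simp only [coeff_map, coeff_mapCoeff, coeff_C_mul, LinearMap.toAddMonoidHom_coe]
      rw [Algebra.algebraMap_eq_smul_one (coeff k g0), map_smul, smul_eq_mul, map_mul, mul_comm,
        Algebra.algebraMap_eq_smul_one (coeff k g0)]
    rw [this]
    exact J.mul_mem_left _ hg
  | smul a g hg ih =>
    have := ih (l.comp (LinearMap.mulLeft C a))
    convert this using 2
    ext k
    simp


theorem comap_le_of_surjective {P : Type*} [CommRing P] [IsNoetherianRing P] (t : P →+* P)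
    (ht : Function.Surjective t) (I : Ideal P) (hI : I ≤ I.comap t) : I.comap t ≤ I := by
  have hmono : Monotone (fun k : ℕ => I.comap (t ^ k)) := by
    refine monotone_nat_of_le_succ fun k x hx => ?_
    rw [Ideal.mem_comap] at hx ⊢
    rw [pow_succ']
    exact hI hx
  obtain ⟨k, hk⟩ := monotone_stabilizes_iff_noetherian.2
    (inferInstance : IsNoetherian P P) ⟨_, hmono⟩
  have hsurj : ∀ k : ℕ, Function.Surjective (t ^ k) := by
    intro k
    rw [RingHom.coe_pow]
    exact ht.iterate k
  intro x hx
  obtain ⟨y, rfl⟩ := hsurj k x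
  have h1 : y ∈ I.comap (t ^ (k + 1)) := by
    rw [Ideal.mem_comap, pow_succ']
    exact hx
  have h2 := hk (k + 1) (Nat.le_succ k)
  have h3 : I.comap (t ^ k) = I.comap (t ^ (k + 1)) := h2
  rw [← h3] at h1
  exact h1

theorem apply_eval {s C M : Type*} [Field C] [Field M] [Algebra C M] (l : M →ₗ[C] C)
    (c : s → C) (F : MvPolynomial s M) :
    l (eval (fun i => algebraMap C M (c i)) F) = eval c (mapCoeff s l.toAddMonoidHom F) := by
  induction F using MvPolynomial.induction_on' with
  | add p q hp hq => simp only [map_add, hp, hq]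
  | monomial m a =>
    rw [mapCoeff_monomial, eval_monomial, eval_monomial]
    have : (m.prod fun i k => algebraMap C M (c i) ^ k) =
        algebraMap C M (m.prod fun i k => c i ^ k) := by
      rw [map_finsuppProd]
      simp
    rw [this, mul_comm, ← Algebra.smul_def, map_smul, smul_eq_mul, mul_comm]
    rfl

theorem sum_coords {s C M : Type*} [Field C] [Field M] [Algebra C M] (F : MvPolynomial s M)
    (J : Ideal (MvPolynomial s M))
    (h : ∀ l : M →ₗ[C] C,
      MvPolynomial.map (algebraMap C M) (mapCoeff s l.toAddMonoidHom F) ∈ J) : F ∈ J := by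
  classical
  let b := Module.Basis.ofVectorSpace C M
  let t := F.support.biUnion (fun m => (b.repr (coeff m F)).support)
  have : F = ∑ α ∈ t, MvPolynomial.C (b α) *
      MvPolynomial.map (algebraMap C M) (mapCoeff s (b.coord α).toAddMonoidHom F) := by
    ext m
    rw [coeff_sum]
    simp only [coeff_C_mul, coeff_map, coeff_mapCoeff]
    by_cases hm : m ∈ F.support
    · conv_lhs => rw [← b.linearCombination_repr (coeff m F), Finsupp.linearCombination_apply]
      rw [Finsupp.sum_of_support_subset (s := t)]
      · refine Finset.sum_congr rfl fun α _ => ?_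
        rw [Algebra.smul_def, mul_comm]
        rfl
      · exact Finset.subset_biUnion_of_mem (fun m => (b.repr (coeff m F)).support) hm
      · simp
    · rw [notMem_support_iff.1 hm]
      simp
  rw [this]
  exact J.sum_mem fun α _ => J.mul_mem_left _ (h _)

theorem exists_point {s C M : Type*} [Finite s] [Field C] [IsAlgClosed C] [Field M] [Algebra C M]
    (d : M →+ M) (hd1 : d 1 = 0)
    (hconst : ∀ x, d x = 0 → ∃ c : C, algebraMap C M c = x)
    (J : Ideal (MvPolynomial s M)) (hJ : ∀ f ∈ J, mapCoeff s d f ∈ J)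
    (G : MvPolynomial s M) (hG : G ∉ J.radical) :
    ∃ c : s → C, (∀ F ∈ J, eval (fun i => algebraMap C M (c i)) F = 0) ∧
      eval (fun i => algebraMap C M (c i)) G ≠ 0 := by
  by_contra! hcon
  apply hG
  apply sum_coords (C := C)
  intro l
  let J0 : Ideal (MvPolynomial s C) := J.comap (MvPolynomial.map (algebraMap C M))
  suffices h : mapCoeff s l.toAddMonoidHom G ∈ J0.radical by
    obtain ⟨N, hN⟩ := h
    refine ⟨N, ?_⟩
    have := Ideal.mem_comap.1 hN
    rwa [map_pow] at this
  rw [← vanishingIdeal_zeroLocus_eq_radical (K := C), mem_vanishingIdeal_iff]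
  intro c hc
  have hvan : ∀ F ∈ J, eval (fun i => algebraMap C M (c i)) F = 0 := by
    intro F hF
    rw [← (Module.Basis.ofVectorSpace C M).forall_coord_eq_zero_iff]
    intro α
    rw [apply_eval]
    have := hc _ (Ideal.mem_comap.2 (mapCoeff_mem d hd1 hconst J hJ
      ((Module.Basis.ofVectorSpace C M).coord α) F hF))
    simpa using this
  have := hcon c hvan
  change eval c _ = 0
  rw [← apply_eval, this, map_zero]

section Deriv
variable {n K : Type*} [Fintype n] [Field K]

/-- The derivation on polynomials in a generic matrix. -/
noncomputable def dY (d : K →+ K) (A : Matrix n n K) (f : MvPolynomial (n × n) K) :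
    MvPolynomial (n × n) K :=
  mapCoeff _ d f + mkDerivation K (fun p : n × n => ∑ k, C (A p.1 k) * X (k, p.2)) f

theorem apply_dY {S : Type*} [CommRing S] (d : K →+ K)
    (hd : ∀ x y, d (x * y) = x * d y + y * d x) (A : Matrix n n K)
    (E : S →+ S) (hE : ∀ x y, E (x * y) = x * E y + y * E x)
    (φ : MvPolynomial (n × n) K →+* S) (hC : ∀ a, E (φ (C a)) = φ (C (d a)))
    (hX : ∀ i j, E (φ (X (i, j))) = φ (∑ k, C (A i k) * X (k, j)))
    (f : MvPolynomial (n × n) K) : E (φ f) = φ (dY d A f) := by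
  have hd1 : d 1 = 0 := by have := hd 1 1; simpa using this
  induction f using MvPolynomial.induction_on with
  | C a =>
    have : mapCoeff (n × n) d (C a) = C (d a) := mapCoeff_monomial d 0 a
    rw [dY, this, hC, derivation_C, add_zero]
  | add p q hp hq =>
    rw [map_add, map_add, hp, hq]
    simp only [dY, map_add]
    ring
  | mul_X p i hp =>
    have h1 : mapCoeff (n × n) d (X i) = 0 := by
      have := mapCoeff_monomial d (Finsupp.single i 1) 1
      rw [hd1, map_zero] at this
      exact this
    rw [map_mul, hE, hp, hX i.1 i.2]
    simp only [dY, map_add, mapCoeff_mul d hd, Derivation.leibniz, h1, mkDerivation_X, map_mul,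
      smul_eq_mul]
    simp
    ring

end Deriv

section Main
variable {n C K M : Type*} [Fintype n] [DecidableEq n] [Field C] [Field K] [Field M]
  [Algebra C K] [Algebra K M] [Algebra C M] [IsScalarTower C K M]

/-- Evaluation at the fundamental matrix. -/
noncomputable def ev (K : Type*) {M : Type*} [Field K] [Field M] [Algebra K M]
    (U : Matrix n n M) : MvPolynomial (n × n) K →+* M :=
  eval₂Hom (algebraMap K M) (fun p => U p.1 p.2)

/-- Evaluation at `U * X`. -/
noncomputable def phi (K : Type*) {M : Type*} [Field K] [Field M] [Algebra K M]
    (U : Matrix n n M) : MvPolynomial (n × n) K →+* MvPolynomial (n × n) M :=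
  eval₂Hom (MvPolynomial.C.comp (algebraMap K M))
    (fun p => ∑ k, MvPolynomial.C (U p.1 k) * X (k, p.2))

theorem ideal_stable (d : K →+ K) (hd : ∀ x y, d (x * y) = x * d y + y * d x)
    (D : M →+ M) (hD : ∀ x y, D (x * y) = x * D y + y * D x)
    (hdD : ∀ a, D (algebraMap K M a) = algebraMap K M (d a))
    (U : Matrix n n M) (A : Matrix n n K)
    (hU : ∀ i j, D (U i j) = ∑ k, algebraMap K M (A i k) * U k j) :
    ∀ f ∈ Ideal.map (phi K U) (RingHom.ker (ev K U)),
      mapCoeff (n × n) D f ∈ Ideal.map (phi K U) (RingHom.ker (ev K U)) := by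
  have hD1 : D 1 = 0 := by have := hD 1 1; simpa using this
  have hmC : ∀ a : M, mapCoeff (n × n) D (MvPolynomial.C a) = MvPolynomial.C (D a) :=
    fun a => mapCoeff_monomial D 0 a
  have hmX : ∀ i, mapCoeff (n × n) D (X i) = 0 := fun i => by
    have := mapCoeff_monomial D (Finsupp.single i 1) 1
    rw [hD1, map_zero] at this
    exact this
  have e1 : ∀ f, D (ev K U f) = ev K U (dY d A f) := by
    refine apply_dY d hd A D hD (ev K U) ?_ ?_
    · intro a; simp [ev, hdD]
    · intro i j; simp [ev, hU]
  have e2 : ∀ f, mapCoeff (n × n) D (phi K U f) = phi K U (dY d A f) := by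
    refine apply_dY d hd A (mapCoeff (n × n) D) (mapCoeff_mul D hD) (phi K U) ?_ ?_
    · intro a; simp [phi, hdD, hmC]
    · intro i j
      simp only [phi, coe_eval₂Hom, eval₂_X, eval₂_sum, eval₂_mul, eval₂_C, map_sum,
        mapCoeff_mul D hD, hmX, hmC, hU, RingHom.comp_apply, map_mul]
      simp only [mul_zero, zero_add, Finset.mul_sum]
      rw [Finset.sum_comm]
      exact Finset.sum_congr rfl fun k _ => Finset.sum_congr rfl fun l _ => by ring
  intro f hf
  refine Submodule.span_induction ?_ ?_ ?_ ?_ hf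
  · rintro _ ⟨g, hg, rfl⟩
    rw [e2]
    refine Ideal.mem_map_of_mem _ ?_
    rw [RingHom.mem_ker, ← e1, (RingHom.mem_ker).1 hg, map_zero]
  · rw [map_zero]; exact Ideal.zero_mem _
  · intro x y _ _ hx hy
    rw [map_add]; exact Ideal.add_mem _ hx hy
  · intro a x hx' hx
    rw [smul_eq_mul, mapCoeff_mul D hD]
    exact Ideal.add_mem _ (Ideal.mul_mem_left _ _ hx) (Ideal.mul_mem_right _ _ hx')

theorem not_mem_radical [CharZero K] (U : Matrix n n M) (hdet : U.det ≠ 0)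
    (z : M) (hz : z ∉ Set.range (algebraMap K M))
    (p q : MvPolynomial (n × n) K) (hq : ev K U q ≠ 0) (hpq : z * ev K U q = ev K U p) :
    (Matrix.of fun i j : n => (X (i, j) : MvPolynomial (n × n) M)).det *
      (MvPolynomial.C z * phi K U q - phi K U p) ∉
      (Ideal.map (phi K U) (RingHom.ker (ev K U))).radical := by
  obtain ⟨Ω, _, f, g, hfg, hne⟩ := exists_two_embeddings z hz
  let Y : Matrix n n Ω := U⁻¹.map f * U.map g
  let Ψ : MvPolynomial (n × n) M →+* Ω := eval₂Hom f (fun p => Y p.1 p.2)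
  have hUY : U.map f * Y = U.map g := by
    rw [← Matrix.mul_assoc, ← Matrix.map_mul, Matrix.mul_nonsing_inv _ (isUnit_iff_ne_zero.2 hdet),
      Matrix.map_one _ (map_zero f) (map_one f), Matrix.one_mul]
  have hdetg : (U.map g).det ≠ 0 := by
    have := RingHom.map_det g U
    rw [RingHom.mapMatrix_apply] at this
    rw [← this]
    exact (map_ne_zero g).2 hdet
  have hY : Y.det ≠ 0 := by
    intro h
    rw [← hUY, Matrix.det_mul, h, mul_zero] at hdetg
    exact hdetg rfl
  have hΨ : Ψ.comp (phi K U) = g.comp (ev K U) := by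
    apply MvPolynomial.ringHom_ext
    · intro a; simp [Ψ, phi, ev, hfg]
    · rintro ⟨i, j⟩
      have := congrFun (congrFun hUY i) j
      rw [Matrix.mul_apply] at this
      simpa [Ψ, phi, ev] using this
  have hker : Ideal.map (phi K U) (RingHom.ker (ev K U)) ≤ RingHom.ker Ψ := by
    rw [Ideal.map_le_iff_le_comap]
    intro x hx
    rw [Ideal.mem_comap, RingHom.mem_ker]
    have := RingHom.congr_fun hΨ x
    rw [RingHom.comp_apply, RingHom.comp_apply, (RingHom.mem_ker).1 hx, map_zero] at this
    exact this
  intro hmem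
  obtain ⟨N, hN⟩ := hmem
  have h0 := (RingHom.mem_ker).1 (hker hN)
  rw [map_pow] at h0
  have h1 := eq_zero_of_pow_eq_zero h0
  have h2 : Ψ (Matrix.of fun i j : n => (X (i, j) : MvPolynomial (n × n) M)).det = Y.det := by
    rw [RingHom.map_det]
    congr 1
    ext i j
    simp [Ψ]
  have h3 := RingHom.congr_fun hΨ q
  have h4 := RingHom.congr_fun hΨ p
  rw [RingHom.comp_apply, RingHom.comp_apply] at h3 h4
  rw [map_mul, map_sub, map_mul, h2, h3, h4, ← hpq, map_mul] at h1
  have h5 : Ψ (MvPolynomial.C z) = f z := by simp [Ψ]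
  rw [h5, ← sub_mul] at h1
  have h6 : g (ev K U q) ≠ 0 := (map_ne_zero g).2 hq
  exact (mul_ne_zero hY (mul_ne_zero (sub_ne_zero.2 hne) h6)) h1

theorem main [CharZero K] [IsAlgClosed C]
    (d : K →+ K) (hd : ∀ x y, d (x * y) = x * d y + y * d x)
    (D : M →+ M) (hD : ∀ x y, D (x * y) = x * D y + y * D x)
    (hdD : ∀ a, D (algebraMap K M a) = algebraMap K M (d a))
    (hDC : ∀ c : C, D (algebraMap C M c) = 0)
    (hconst : ∀ x, D x = 0 → ∃ c : C, algebraMap C M c = x)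
    (U : Matrix n n M) (A : Matrix n n K)
    (hU : ∀ i j, D (U i j) = ∑ k, algebraMap K M (A i k) * U k j)
    (hdet : U.det ≠ 0)
    (hfrac : ∀ x : M, ∃ p q, ev K U q ≠ 0 ∧ x * ev K U q = ev K U p)
    (z : M) (hz : z ∉ Set.range (algebraMap K M)) :
    ∃ σ : M ≃+* M, (∀ c : K, σ (algebraMap K M c) = algebraMap K M c) ∧
      (∀ x : M, σ (D x) = D (σ x)) ∧ σ z ≠ z := by
  have hD1 : D 1 = 0 := by have := hD 1 1; simpa using this
  obtain ⟨p, q, hq, hpq⟩ := hfrac z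
  obtain ⟨c, hc1, hc2⟩ := exists_point D hD1 hconst _ (ideal_stable d hd D hD hdD U A hU) _
    (not_mem_radical U hdet z hz p q hq hpq)
  let c' : Matrix n n C := Matrix.of fun i j => c (i, j)
  let rho : MvPolynomial (n × n) K →+* M :=
    eval₂Hom (algebraMap K M) (fun p => ∑ k, U p.1 k * algebraMap C M (c (k, p.2)))
  have hrho : ∀ f, eval (fun i => algebraMap C M (c i)) (phi K U f) = rho f := by
    intro f
    have : (eval (fun i => algebraMap C M (c i))).comp (phi K U) = rho := by
      apply MvPolynomial.ringHom_ext
      · intro a; simp [rho, phi]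
      · intro i; simp [rho, phi]
    rw [← this]; rfl
  have hcdet : c'.det ≠ 0 := by
    intro h
    apply hc2
    rw [map_mul, RingHom.map_det]
    have : (eval (fun i => algebraMap C M (c i))).mapMatrix
        (Matrix.of fun i j : n => (X (i, j) : MvPolynomial (n × n) M)) =
        (algebraMap C M).mapMatrix c' := by
      ext i j
      simp [c']
    rw [this, ← RingHom.map_det, h, map_zero, zero_mul]
  have hne : z * rho q - rho p ≠ 0 := by
    intro h
    apply hc2
    rw [map_mul, map_sub, map_mul, hrho, hrho, eval_C, h, mul_zero]
  let t : MvPolynomial (n × n) K →+* MvPolynomial (n × n) K :=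
    eval₂Hom MvPolynomial.C
      (fun p => ∑ k, X (p.1, k) * MvPolynomial.C (algebraMap C K (c (k, p.2))))
  have hevt : ∀ f, ev K U (t f) = rho f := by
    intro f
    have : (ev K U).comp t = rho := by
      apply MvPolynomial.ringHom_ext
      · intro a; simp [rho, ev, t]
      · intro i
        simp [rho, ev, t, ← IsScalarTower.algebraMap_apply C K M]
    rw [← this]; rfl
  have hcinv : c' * c'⁻¹ = 1 := Matrix.mul_nonsing_inv _ (isUnit_iff_ne_zero.2 hcdet)
  let t' : MvPolynomial (n × n) K →+* MvPolynomial (n × n) K :=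
    eval₂Hom MvPolynomial.C
      (fun p => ∑ k, X (p.1, k) * MvPolynomial.C (algebraMap C K (c'⁻¹ k p.2)))
  have htt : t.comp t' = RingHom.id _ := by
    apply MvPolynomial.ringHom_ext
    · intro a; simp [t, t']
    · rintro ⟨i, j⟩
      simp only [t, t', RingHom.comp_apply, coe_eval₂Hom, eval₂_X, eval₂_sum, eval₂_mul, eval₂_C,
        RingHom.id_apply, Finset.sum_mul]
      rw [Finset.sum_comm]
      have : ∀ l : n, ∑ k : n, X (i, l) * MvPolynomial.C (algebraMap C K (c (l, k))) *
          MvPolynomial.C (algebraMap C K (c'⁻¹ k j)) =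
          (X (i, l) : MvPolynomial (n × n) K) *
            MvPolynomial.C (algebraMap C K ((1 : Matrix n n C) l j)) := by
        intro l
        rw [← hcinv, Matrix.mul_apply, map_sum, map_sum, Finset.mul_sum]
        refine Finset.sum_congr rfl fun k _ => ?_
        rw [map_mul, map_mul, mul_assoc]
        rfl
      rw [Finset.sum_congr rfl fun l _ => this l, Finset.sum_eq_single j]
      · simp
      · intro b _ hb; simp [Matrix.one_apply_ne hb]
      · simp
  have htsurj : Function.Surjective t := fun x => ⟨t' x, RingHom.congr_fun htt x⟩
  let I := RingHom.ker (ev K U)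
  have hI : I ≤ I.comap t := by
    intro f hf
    rw [Ideal.mem_comap, RingHom.mem_ker, hevt, ← hrho]
    exact hc1 _ (Ideal.mem_map_of_mem _ hf)
  have hI' := comap_le_of_surjective t htsurj I hI
  have hrho0 : ∀ f, rho f = 0 ↔ ev K U f = 0 := by
    intro f
    rw [← hevt]
    exact ⟨fun h => hI' h, fun h => hI h⟩
  let Q := MvPolynomial (n × n) K ⧸ I
  let e : Q →+* M := Ideal.Quotient.lift I (ev K U) (fun a ha => ha)
  let r : Q →+* M := Ideal.Quotient.lift I rho (fun a ha => (hrho0 a).2 ha)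
  have he : Function.Injective e := by
    rw [injective_iff_map_eq_zero]
    intro x hx
    obtain ⟨x, rfl⟩ := Ideal.Quotient.mk_surjective x
    exact Ideal.Quotient.eq_zero_iff_mem.2 hx
  have hr : Function.Injective r := by
    rw [injective_iff_map_eq_zero]
    intro x hx
    obtain ⟨x, rfl⟩ := Ideal.Quotient.mk_surjective x
    exact Ideal.Quotient.eq_zero_iff_mem.2 ((hrho0 x).1 hx)
  let _ : Algebra Q M := e.toAlgebra
  have : FaithfulSMul Q M := (faithfulSMul_iff_algebraMap_injective Q M).2 he
  have : IsDomain Q := he.isDomain e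
  have : IsFractionRing Q M := by
    apply IsFractionRing.of_field
    intro x
    obtain ⟨p, q, hq, h⟩ := hfrac x
    exact ⟨Ideal.Quotient.mk I p, Ideal.Quotient.mk I q, (eq_div_iff hq).2 h⟩
  let s : M →+* M := IsFractionRing.lift (A := Q) (K := M) (g := r) hr
  have hs : ∀ f, s (ev K U f) = rho f := fun f =>
    IsFractionRing.lift_algebraMap (A := Q) (K := M) (g := r) hr (Ideal.Quotient.mk I f)
  have hssurj : Function.Surjective s := by
    intro x
    obtain ⟨p, q, hq, h⟩ := hfrac x
    obtain ⟨p, rfl⟩ := htsurj p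
    obtain ⟨q, rfl⟩ := htsurj q
    rw [hevt] at hq
    rw [hevt, hevt, ← hs, ← hs] at h
    rw [← hs] at hq
    exact ⟨ev K U p / ev K U q, by rw [map_div₀, div_eq_iff hq, h]⟩
  have e1 : ∀ f, D (ev K U f) = ev K U (dY d A f) := by
    refine apply_dY d hd A D hD (ev K U) ?_ ?_
    · intro a; simp [ev, hdD]
    · intro i j; simp [ev, hU]
  have e2 : ∀ f, D (rho f) = rho (dY d A f) := by
    refine apply_dY d hd A D hD rho ?_ ?_
    · intro a; simp [rho, hdD]
    · intro i j
      simp only [rho, coe_eval₂Hom, eval₂_X, eval₂_sum, eval₂_mul, eval₂_C, map_sum, hD, hDC, hU]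
      simp only [mul_zero, zero_add, Finset.mul_sum]
      rw [Finset.sum_comm]
      exact Finset.sum_congr rfl fun k _ => Finset.sum_congr rfl fun l _ => by ring
  have e3 : ∀ f, s (D (ev K U f)) = D (s (ev K U f)) := by
    intro f
    rw [e1, hs, hs, e2]
  refine ⟨RingEquiv.ofBijective s ⟨s.injective, hssurj⟩, ?_, ?_, ?_⟩
  · intro a
    change s (algebraMap K M a) = _
    have := hs (MvPolynomial.C a)
    simpa [ev, rho] using this
  · intro x
    change s (D x) = D (s x)
    obtain ⟨p, q, hq, h⟩ := hfrac x
    have hsq : s (ev K U q) ≠ 0 := (map_ne_zero s).2 hq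
    have h1 := congrArg (fun y => s (D y)) h
    have h2 := congrArg (fun y => D (s y)) h
    simp only [hD, map_mul, map_add, e3] at h1 h2
    have h3 := h1.trans h2.symm
    have h4 : s (ev K U q) * s (D x) = s (ev K U q) * D (s x) := add_left_cancel h3
    exact mul_left_cancel₀ hsq h4
  · change s z ≠ z
    intro h
    apply hne
    rw [← hs, ← hs, ← hpq, map_mul, h, sub_self]

end Main
end Two

end PVNormal


/-- Let `K` be a differential field of characteristic zero whose field of
constants is algebraically closed, and let `M = K(u 0, …, u (n-1))` be a Picard-Vessiot
extension of `K` (embedding `ι`, derivations `δK`, `δM`, fundamental system of solutions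
`u` of a linear homogeneous differential equation over `K`, same constants as `K`). Then
`M/K` is normal in the differential sense: for every `z ∈ M` not in (the image of) `K`
there is a differential `K`-automorphism `σ` of `M` with `σ z ≠ z`. -/
theorem picardVessiot_is_normal
    {K M : Type*} [Field K] [CharZero K] [Field M]
    (δK : K → K)
    (hKadd : ∀ x y, δK (x + y) = δK x + δK y)
    (hKmul : ∀ x y, δK (x * y) = x * δK y + y * δK x)
    (halgclosed : ∀ p : Polynomial K, (∀ i, δK (p.coeff i) = 0) → 0 < p.degree →
      ∃ c : K, δK c = 0 ∧ Polynomial.eval c p = 0)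
    (ι : K →+* M) (δM : M → M)
    (hMadd : ∀ x y, δM (x + y) = δM x + δM y)
    (hMmul : ∀ x y, δM (x * y) = x * δM y + y * δM x)
    (hcompat : ∀ c : K, δM (ι c) = ι (δK c))
    (n : ℕ) (a : Fin n → K) (u : Fin n → M)
    (hsol : ∀ i, δM^[n] (u i) + ∑ j : Fin n, ι (a j) * δM^[n - 1 - (j : ℕ)] (u i) = 0)
    (hwronskian : Matrix.det (Matrix.of fun i j : Fin n => δM^[(i : ℕ)] (u j)) ≠ 0)
    (hgen : Subfield.closure (Set.range ι ∪ Set.range u) = ⊤)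
    (hconst : ∀ z : M, δM z = 0 → ∃ c : K, δK c = 0 ∧ ι c = z)
    (z : M) (hz : z ∉ Set.range ι) :
    ∃ σ : M ≃+* M, (∀ c : K, σ (ι c) = ι c) ∧ (∀ x : M, σ (δM x) = δM (σ x)) ∧
      σ z ≠ z := by
  classical
  have hK0 : δK 0 = 0 := by have := hKadd 0 0; simpa using this
  have hM0 : δM 0 = 0 := by have := hMadd 0 0; simpa using this
  have hK1 : δK 1 = 0 := by have := hKmul 1 1; simpa using this
  let d : K →+ K := ⟨⟨δK, hK0⟩, hKadd⟩
  let D : M →+ M := ⟨⟨δM, hM0⟩, hMadd⟩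
  let F : Subfield K :=
    { carrier := {x | δK x = 0}
      mul_mem' := fun {x y} hx hy => by
        change δK _ = 0
        rw [hKmul, (show δK x = 0 from hx), (show δK y = 0 from hy)]; simp
      one_mem' := hK1
      add_mem' := fun {x y} hx hy => by
        change δK _ = 0
        rw [hKadd, (show δK x = 0 from hx), (show δK y = 0 from hy)]; simp
      zero_mem' := hK0
      neg_mem' := fun {x} hx => by
        have h := map_neg d x
        have h2 : d x = 0 := hx
        rw [h2, neg_zero] at h
        exact h
      inv_mem' := fun x hx => by
        change δK _ = 0
        by_cases h0 : x = 0
        · rw [h0, inv_zero, hK0]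
        · have h := hKmul x x⁻¹
          rw [mul_inv_cancel₀ h0, hK1, (show δK x = 0 from hx), mul_zero, add_zero] at h
          exact (mul_eq_zero.1 h.symm).resolve_left h0 }
  have hF : ∀ x : F, δK (x : K) = 0 := fun x => x.2
  have : IsAlgClosed F := by
    refine IsAlgClosed.of_exists_root F fun p _ hirr => ?_
    obtain ⟨c, hc, hc2⟩ := halgclosed (p.map F.subtype)
      (fun i => by rw [Polynomial.coeff_map]; exact hF _)
      (by rw [Polynomial.degree_map]; exact Polynomial.degree_pos_of_irreducible hirr)
    refine ⟨⟨c, hc⟩, ?_⟩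
    apply F.subtype_injective
    rw [map_zero, ← hc2, Polynomial.eval_map, Polynomial.eval, Polynomial.hom_eval₂]
    rfl
  let _ : Algebra K M := ι.toAlgebra
  let U : Matrix (Fin n) (Fin n) M := Matrix.of fun i j : Fin n => δM^[(i : ℕ)] (u j)
  let A : Matrix (Fin n) (Fin n) K := Matrix.of fun i k : Fin n =>
    if (i : ℕ) + 1 < n then (if (k : ℕ) = i + 1 then 1 else 0) else -a (Fin.rev k)
  have hU : ∀ i j, D (U i j) = ∑ k, algebraMap K M (A i k) * U k j := by
    intro i j
    have hl : D (U i j) = δM^[(i : ℕ) + 1] (u j) := by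
      rw [Function.iterate_succ_apply']; rfl
    rw [hl]
    by_cases hi : (i : ℕ) + 1 < n
    · rw [Finset.sum_eq_single (⟨(i : ℕ) + 1, hi⟩ : Fin n)]
      · simp [A, U, hi]
      · intro b _ hb
        have : (b : ℕ) ≠ i + 1 := fun h => hb (Fin.ext h)
        simp [A, hi, this]
      · simp
    · have hin : (i : ℕ) + 1 = n := by have := i.2; omega
      rw [hin, eq_neg_of_add_eq_zero_left (hsol j), ← Equiv.sum_comp Fin.revPerm,
        ← Finset.sum_neg_distrib]
      refine Finset.sum_congr rfl fun k _ => ?_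
      have hk : n - 1 - ((Fin.revPerm k : Fin n) : ℕ) = (k : ℕ) := by
        have := k.2
        rw [Fin.revPerm_apply, Fin.val_rev]; omega
      rw [hk]
      simp only [A, U, Matrix.of_apply, if_neg hi, map_neg, neg_mul, Fin.revPerm_apply]
      rfl
  have hev : ∀ x ∈ Subring.closure (Set.range ι ∪ Set.range u), ∃ f, PVNormal.ev K U f = x := by
    intro x hx
    have hle : Subring.closure (Set.range ι ∪ Set.range u) ≤ (PVNormal.ev K U).range := by
      rw [Subring.closure_le]
      rintro y (⟨c, rfl⟩ | ⟨j, rfl⟩)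
      · refine ⟨MvPolynomial.C c, ?_⟩
        rw [PVNormal.ev, MvPolynomial.coe_eval₂Hom, MvPolynomial.eval₂_C]
        rfl
      · have hn : 0 < n := lt_of_le_of_lt (Nat.zero_le _) j.2
        refine ⟨MvPolynomial.X (⟨0, hn⟩, j), ?_⟩
        rw [PVNormal.ev, MvPolynomial.coe_eval₂Hom, MvPolynomial.eval₂_X]
        rfl
    exact hle hx
  have hfrac : ∀ x : M, ∃ p q, PVNormal.ev K U q ≠ 0 ∧
      x * PVNormal.ev K U q = PVNormal.ev K U p := by
    intro x
    have hx : x ∈ Subfield.closure (Set.range ι ∪ Set.range u) := by rw [hgen]; trivial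
    obtain ⟨y, hy, w, hw, rfl⟩ := Subfield.mem_closure_iff.1 hx
    obtain ⟨p, hp⟩ := hev y hy
    obtain ⟨q, hq⟩ := hev w hw
    by_cases hw0 : w = 0
    · exact ⟨0, 1, by rw [map_one]; exact one_ne_zero, by rw [hw0, map_zero]; simp⟩
    · exact ⟨p, q, by rwa [hq], by rw [hp, hq, div_mul_cancel₀ _ hw0]⟩
  exact PVNormal.main (C := F) d hKmul D hMmul hcompat
    (fun c => by
      have h := hcompat (c : K)
      rw [hF c, map_zero] at h
      exact h)
    (fun x hx => by
      obtain ⟨c, hc, hc2⟩ := hconst x hx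
      exact ⟨⟨c, hc⟩, hc2⟩)
    U A hU hwronskian hfrac z hz
end
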